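/- arXiv:2505.06992 — 3 statements merged into one kernel-verified Lean document; each statement's English description precedes it below -/
import Mathlib

section
/- If I is a monomial ideal in R = K[x_1,...,x_n] whose minimal generators u_1,...,u_m form a dominant set (for each generator u_j there is a variable x such that the exponent of x in u_j strictly exceeds its exponent in every other generator), then the projective dimension of I is m − 1, and the top multigraded Betti number β_{m-1,a}(I) equals 1 if x^a = lcm(u_1,...,u_m) and 0 otherwise; moreover β_{i,b}(I) = 0 for i ≠ m−1 where x^b = lcm(u_1,...,u_m). -/
open MvPolynomial

/-- A (multigraded) minimal free resolution of an ideal `I ⊆ K[x_v : v ∈ σ]`,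
recorded through the ranks `rk i` of its free modules, the multidegrees
`deg i j` of their basis elements, the augmentation `aug : F₀ → R` (whose image
is `I`) and the differentials `d i : F_{i+1} → F_i`, given by matrices. -/
structure MinFreeRes {K : Type} [Field K] {σ : Type} (I : Ideal (MvPolynomial σ K)) where
  rk : ℕ → ℕ
  deg : (i : ℕ) → Fin (rk i) → (σ →₀ ℕ)
  aug : (Fin (rk 0) → MvPolynomial σ K) →ₗ[MvPolynomial σ K] MvPolynomial σ K
  d : (i : ℕ) → Matrix (Fin (rk i)) (Fin (rk (i + 1))) (MvPolynomial σ K)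
  aug_homog : ∀ j, (aug (Pi.single j 1)).support ⊆ {deg 0 j}
  d_homog : ∀ i j k, ∀ m ∈ (d i j k).support, deg i j + m = deg (i + 1) k
  minimal : ∀ i j k, MvPolynomial.coeff (0 : σ →₀ ℕ) (d i j k) = 0
  range_aug : ∀ p, p ∈ LinearMap.range aug ↔ p ∈ I
  exact_zero : LinearMap.range (Matrix.mulVecLin (d 0)) = LinearMap.ker aug
  exact_succ : ∀ i,
    LinearMap.range (Matrix.mulVecLin (d (i + 1))) = LinearMap.ker (Matrix.mulVecLin (d i))

/-- The multigraded Betti number `β_{i,a}(I)`: the number of basis elements of the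
`i`-th free module in the minimal free resolution with multidegree `a`. -/
noncomputable def MinFreeRes.cnt {K : Type} [Field K] {σ : Type}
    {I : Ideal (MvPolynomial σ K)} (F : MinFreeRes I) (i : ℕ) (a : σ →₀ ℕ) : ℕ :=
  Nat.card {j : Fin (F.rk i) // F.deg i j = a}

/-- `F` witnesses that `pdim I = p`. -/
def MinFreeRes.IsPdim {K : Type} [Field K] {σ : Type}
    {I : Ideal (MvPolynomial σ K)} (F : MinFreeRes I) (p : ℕ) : Prop :=
  F.rk p ≠ 0 ∧ ∀ i, p < i → F.rk i = 0

/-- `F` witnesses that `reg I = r`, i.e. `r = max { |a| - i : β_{i,a}(I) ≠ 0 }`. -/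
def MinFreeRes.IsReg {K : Type} [Field K] {σ : Type}
    {I : Ideal (MvPolynomial σ K)} (F : MinFreeRes I) (r : ℤ) : Prop :=
  (∃ i j, ((F.deg i j).sum fun _ e => e : ℤ) - i = r) ∧
    ∀ i j, ((F.deg i j).sum fun _ e => e : ℤ) - i ≤ r

/-- `I` is a monomial ideal. -/
def IsMonomialIdeal {K : Type} [Field K] {σ : Type} (I : Ideal (MvPolynomial σ K)) : Prop :=
  ∃ S : Set (σ →₀ ℕ), I = Ideal.span ((fun a => monomial a (1 : K)) '' S)


/-- Scalar (strand-wise) version of a multigraded minimal resolution of `R/I`. -/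
structure Cx {K : Type} [Field K] {σ : Type} (ι : ℕ → Type) (S : ∀ i, Finset (ι i))
    (deg : ∀ i, ι i → σ → ℤ) (d : ∀ i, ι i → ι (i + 1) → K) (e0 : ι 0) {m : ℕ}
    (u : Fin m → σ → ℤ) : Prop where
  S0 : ∀ j, j ∈ S 0 ↔ j = e0
  strict : ∀ i j k, d i j k ≠ 0 → deg i j < deg (i + 1) k
  dd : ∀ i, ∀ j ∈ S i, ∀ l ∈ S (i + 2), ∑ k ∈ S (i + 1), d i j k * d (i + 1) k l = 0
  ex : ∀ i (a : σ → ℤ) (v : ι (i + 1) → K), (∀ k, v k ≠ 0 → k ∈ S (i + 1) ∧ deg (i + 1) k ≤ a) →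
    (∀ j ∈ S i, ∑ k ∈ S (i + 1), d i j k * v k = 0) →
    ∃ w : ι (i + 2) → K, (∀ l, w l ≠ 0 → l ∈ S (i + 2) ∧ deg (i + 2) l ≤ a) ∧
      ∀ k ∈ S (i + 1), v k = ∑ l ∈ S (i + 2), d (i + 1) k l * w l
  A1 : ∀ k ∈ S 1, d 0 e0 k ≠ 0 → ∃ g, u g ≤ deg 1 k
  A2 : ∀ g, ∃ k ∈ S 1, d 0 e0 k ≠ 0 ∧ deg 1 k ≤ u g

namespace Cx

variable {K : Type} [Field K] {σ : Type} {ι : ℕ → Type} {S : ∀ i, Finset (ι i)}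
    {deg : ∀ i, ι i → σ → ℤ} {d : ∀ i, ι i → ι (i + 1) → K} {e0 : ι 0} {m : ℕ}

theorem min_aux {u : Fin m → σ → ℤ} (h : Cx ι S deg d e0 u) (i : ℕ) (v : ι (i + 1) → K)
    (k : ι (i + 1)) (hk : k ∈ S (i + 1)) (hvk : v k ≠ 0)
    (hv : ∀ k', v k' ≠ 0 → k' ∈ S (i + 1) ∧ deg (i + 1) k' ≤ deg (i + 1) k)
    (hc : ∀ j ∈ S i, ∑ k ∈ S (i + 1), d i j k * v k = 0) : False := by
  obtain ⟨w, hw, hvw⟩ := h.ex i _ v hv hc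
  have h1 := hvw k hk
  rw [h1] at hvk
  obtain ⟨l, hl, hne⟩ := Finset.exists_ne_zero_of_sum_ne_zero hvk
  have h2 := h.strict (i + 1) k l (left_ne_zero_of_mul hne)
  have h3 := (hw l (right_ne_zero_of_mul hne)).2
  exact absurd (lt_of_lt_of_le h2 h3) (lt_irrefl _)

theorem col_ne {u : Fin m → σ → ℤ} (h : Cx ι S deg d e0 u) (i : ℕ)
    (k : ι (i + 1)) (hk : k ∈ S (i + 1)) : ∃ j ∈ S i, d i j k ≠ 0 := by
  classical
  by_contra hcon
  push Not at hcon
  refine h.min_aux i (Pi.single k 1) k hk (by simp) ?_ ?_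
  · intro k' hk'
    by_cases hkk : k' = k
    · subst hkk; exact ⟨hk, le_rfl⟩
    · simp [hkk] at hk'
  · intro j hj
    apply Finset.sum_eq_zero
    intro k' _
    by_cases hkk : k' = k
    · subst hkk; simp [hcon j hj]
    · simp [hkk]

theorem base {u : Fin 0 → σ → ℤ} (h : Cx ι S deg d e0 u) : ∀ i, S (i + 1) = ∅ := by
  intro i
  induction i with
  | zero =>
    rw [Finset.eq_empty_iff_forall_notMem]
    intro k hk
    obtain ⟨j, hj, hd⟩ := h.col_ne 0 k hk
    rw [h.S0] at hj
    subst hj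
    obtain ⟨g, _⟩ := h.A1 k hk hd
    exact g.elim0
  | succ i ih =>
    rw [Finset.eq_empty_iff_forall_notMem]
    intro k hk
    obtain ⟨j, hj, hd⟩ := h.col_ne (i + 1) k hk
    rw [ih] at hj
    simp at hj

theorem aug_ne {u : Fin m → σ → ℤ} (h : Cx ι S deg d e0 u)
    (k : ι 1) (hk : k ∈ S 1) : d 0 e0 k ≠ 0 := by
  obtain ⟨j, hj, hd⟩ := h.col_ne 0 k hk
  rw [h.S0] at hj
  subst hj
  exact hd

/-- the difference vector of two generators -/
theorem diff_cycle {u : Fin m → σ → ℤ} (h : Cx ι S deg d e0 u) (a : σ → ℤ)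
    (k k' : ι 1) (hk : k ∈ S 1) (hk' : k' ∈ S 1) (hne : k ≠ k') (ha : deg 1 k ≤ a)
    (ha' : deg 1 k' ≤ a) :
    ∃ v : ι 1 → K, v k = 1 ∧ (∀ l, v l ≠ 0 → l ∈ S 1 ∧ deg 1 l ≤ a) ∧
      (∀ j ∈ S 0, ∑ l ∈ S 1, d 0 j l * v l = 0) := by
  classical
  have h1 := h.aug_ne k hk
  have h2 := h.aug_ne k' hk'
  refine ⟨Pi.single k 1 - Pi.single k' (d 0 e0 k / d 0 e0 k'), ?_, ?_, ?_⟩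
  · simp [hne]
  · intro l hl
    by_cases hl1 : l = k
    · subst hl1; exact ⟨hk, ha⟩
    by_cases hl2 : l = k'
    · subst hl2; exact ⟨hk', ha'⟩
    simp [hl1, hl2] at hl
  · intro j hj
    rw [h.S0] at hj
    subst hj
    simp only [Pi.sub_apply, mul_sub, Finset.sum_sub_distrib]
    simp only [Pi.single_apply, mul_ite, mul_zero, mul_one, Finset.sum_ite_eq', hk, hk', if_true]
    field_simp
    ring

theorem gen_unique {u : Fin m → σ → ℤ} (h : Cx ι S deg d e0 u)
    (k k' : ι 1) (hk : k ∈ S 1) (hk' : k' ∈ S 1) (hle : deg 1 k' ≤ deg 1 k) : k = k' := by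
  by_contra hne
  obtain ⟨v, hv1, hv2, hv3⟩ := h.diff_cycle (deg 1 k) k k' hk hk' hne le_rfl hle
  exact h.min_aux 0 v k hk (by simp [hv1]) hv2 hv3

theorem lower {u : Fin (m + 1) → σ → ℤ} (h : Cx ι S deg d e0 u) (x : σ)
    (hx : ∀ g : Fin m, u g.castSucc x < u (Fin.last m) x) (h0 : deg 0 e0 x < u (Fin.last m) x) :
    Cx ι (fun i => (S i).filter (fun j => deg i j x < u (Fin.last m) x)) deg d e0
      (fun g : Fin m => u g.castSucc) := by
  classical
  have key : ∀ i j k, d i j k ≠ 0 → deg (i + 1) k x < u (Fin.last m) x →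
      deg i j x < u (Fin.last m) x := fun i j k hd hk =>
    lt_of_le_of_lt ((h.strict i j k hd).le x) hk
  refine ⟨?_, h.strict, ?_, ?_, ?_, ?_⟩
  · intro j
    rw [Finset.mem_filter, h.S0]
    constructor
    · exact fun h => h.1
    · rintro rfl; exact ⟨rfl, h0⟩
  · intro i j hj l hl
    rw [Finset.mem_filter] at hj hl
    rw [← h.dd i j hj.1 l hl.1]
    apply Finset.sum_subset (Finset.filter_subset _ _)
    intro k hk hk'
    by_contra hne
    exact hk' (Finset.mem_filter.2 ⟨hk, key _ _ _ (right_ne_zero_of_mul hne) hl.2⟩)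
  · intro i a v hv hc
    let a' : σ → ℤ := Function.update a x (min (a x) (u (Fin.last m) x - 1))
    have ha' : a' ≤ a := by
      intro y
      by_cases hy : y = x
      · subst hy; simp [a']
      · simp [a', hy]
    have ha'x : a' x < u (Fin.last m) x := by
      simp only [a', Function.update_self]
      omega
    obtain ⟨w, hw, hvw⟩ := h.ex i a' v (by
      intro k hk
      obtain ⟨h1, h2⟩ := hv k hk
      rw [Finset.mem_filter] at h1
      refine ⟨h1.1, fun y => ?_⟩
      have h2y : deg (i + 1) k y ≤ a y := h2 y
      by_cases hy : y = x
      · subst hy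
        simp only [a', Function.update_self]
        have h1x : deg (i + 1) k y < u (Fin.last m) y := h1.2
        omega
      · simpa [a', hy] using h2y) (by
      intro j hj
      have hsum : ∑ k ∈ S (i + 1), d i j k * v k =
          ∑ k ∈ (S (i + 1)).filter (fun j => deg (i + 1) j x < u (Fin.last m) x),
            d i j k * v k := by
        symm
        apply Finset.sum_subset (Finset.filter_subset _ _)
        intro k hk hk'
        by_contra hne
        exact hk' (hv k (right_ne_zero_of_mul hne)).1
      rw [hsum]
      by_cases hjx : deg i j x < u (Fin.last m) x
      · exact hc j (Finset.mem_filter.2 ⟨hj, hjx⟩)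
      · apply Finset.sum_eq_zero
        intro k hk
        by_contra hne
        exact hjx (key _ _ _ (left_ne_zero_of_mul hne) (Finset.mem_filter.1 hk).2))
    have hwS : ∀ l, w l ≠ 0 →
        l ∈ (S (i + 2)).filter (fun j => deg (i + 2) j x < u (Fin.last m) x) := by
      intro l hl
      obtain ⟨h1, h2⟩ := hw l hl
      exact Finset.mem_filter.2 ⟨h1, lt_of_le_of_lt (h2 x) ha'x⟩
    refine ⟨w, fun l hl => ⟨hwS l hl, (hw l hl).2.trans ha'⟩, ?_⟩
    intro k hk
    rw [hvw k (Finset.mem_filter.1 hk).1]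
    symm
    apply Finset.sum_subset (Finset.filter_subset _ _)
    intro l hl hl'
    by_contra hne
    exact hl' (hwS l (right_ne_zero_of_mul hne))
  · intro k hk hd
    rw [Finset.mem_filter] at hk
    obtain ⟨g, hg⟩ := h.A1 k hk.1 hd
    induction g using Fin.lastCases with
    | last => exact absurd (hg x) (not_le.2 hk.2)
    | cast g => exact ⟨g, hg⟩
  · intro g
    obtain ⟨k, hk, hd, hle⟩ := h.A2 g.castSucc
    exact ⟨k, Finset.mem_filter.2 ⟨hk, lt_of_le_of_lt (hle x) (hx g)⟩, hd, hle⟩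

theorem exists_top {u : Fin (m + 1) → σ → ℤ} (h : Cx ι S deg d e0 u) (x : σ)
    (hx : ∀ g : Fin m, u g.castSucc x < u (Fin.last m) x)
    (hlast : ∀ g : Fin m, ¬ u g.castSucc ≤ u (Fin.last m)) :
    ∃ f0 ∈ S 1, deg 1 f0 = u (Fin.last m) ∧
      ∀ k ∈ S 1, u (Fin.last m) x ≤ deg 1 k x → k = f0 := by
  obtain ⟨f0, hf, hd, hle⟩ := h.A2 (Fin.last m)
  have hdeg : deg 1 f0 = u (Fin.last m) := by
    apply le_antisymm hle
    obtain ⟨g, hg⟩ := h.A1 f0 hf hd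
    induction g using Fin.lastCases with
    | last => exact hg
    | cast g => exact absurd (hg.trans hle) (hlast g)
  refine ⟨f0, hf, hdeg, ?_⟩
  intro k hk hkx
  obtain ⟨g, hg⟩ := h.A1 k hk (h.aug_ne k hk)
  induction g using Fin.lastCases with
  | last => exact h.gen_unique k f0 hk hf (hdeg.trans_le hg)
  | cast g =>
    obtain ⟨k', hk', hd', hle'⟩ := h.A2 g.castSucc
    have := h.gen_unique k k' hk hk' (hle'.trans hg)
    subst this
    exact absurd (lt_of_le_of_lt (hle' x) (hx g)) (not_lt.2 hkx)

theorem upper {u : Fin (m + 1) → σ → ℤ} (h : Cx ι S deg d e0 u) (x : σ)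
    (hx : ∀ g : Fin m, u g.castSucc x < u (Fin.last m) x) (h0 : deg 0 e0 x < u (Fin.last m) x)
    (f0 : ι 1) (hf0 : f0 ∈ S 1) (hdeg : deg 1 f0 = u (Fin.last m))
    (huniq : ∀ k ∈ S 1, u (Fin.last m) x ≤ deg 1 k x → k = f0) :
    Cx (fun i => ι (i + 1))
      (fun i => (S (i + 1)).filter (fun j => u (Fin.last m) x ≤ deg (i + 1) j x))
      (fun i => deg (i + 1)) (fun i => d (i + 1)) f0
      (fun g : Fin m => u g.castSucc ⊔ u (Fin.last m)) := by
  classical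
  have hlow := h.lower x hx h0
  have key : ∀ i j k, d i j k ≠ 0 → u (Fin.last m) x ≤ deg i j x →
      u (Fin.last m) x ≤ deg (i + 1) k x := fun i j k hd hk =>
    hk.trans ((h.strict i j k hd).le x)
  refine ⟨?_, fun i => h.strict (i + 1), ?_, ?_, ?_, ?_⟩
  · intro j
    rw [Finset.mem_filter]
    constructor
    · exact fun h => huniq j h.1 h.2
    · rintro rfl; exact ⟨hf0, by rw [hdeg]⟩
  · intro i j hj l hl
    rw [Finset.mem_filter] at hj hl
    rw [← h.dd (i + 1) j hj.1 l hl.1]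
    apply Finset.sum_subset (Finset.filter_subset _ _)
    intro k hk hk'
    by_contra hne
    exact hk' (Finset.mem_filter.2 ⟨hk, key _ _ _ (left_ne_zero_of_mul hne) hj.2⟩)
  · intro i a v hv hc
    have hvS : ∀ k, v k ≠ 0 → k ∈ S (i + 2) := fun k hk => (Finset.mem_filter.1 (hv k hk).1).1
    -- the boundary of v
    have hsum : ∀ j, ∑ k ∈ S (i + 2), d (i + 1) j k * v k =
        ∑ k ∈ (S (i + 2)).filter (fun j => u (Fin.last m) x ≤ deg (i + 2) j x),
          d (i + 1) j k * v k := by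
      intro j
      symm
      apply Finset.sum_subset (Finset.filter_subset _ _)
      intro k hk hk'
      by_contra hne
      exact hk' (hv k (right_ne_zero_of_mul hne)).1
    let f : ι (i + 1) → K := fun j => if j ∈ S (i + 1) then ∑ k ∈ S (i + 2), d (i + 1) j k * v k else 0
    have hf : ∀ j, f j ≠ 0 →
        j ∈ (S (i + 1)).filter (fun j => deg (i + 1) j x < u (Fin.last m) x) ∧
          deg (i + 1) j ≤ a := by
      intro j hj
      have hjS : j ∈ S (i + 1) := by
        by_contra hcon
        simp [f, hcon] at hj
      simp only [f, hjS, if_true] at hj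
      refine ⟨Finset.mem_filter.2 ⟨hjS, ?_⟩, ?_⟩
      · by_contra hcon
        rw [hsum] at hj
        exact hj (hc j (Finset.mem_filter.2 ⟨hjS, not_lt.1 hcon⟩))
      · obtain ⟨k, hk, hne⟩ := Finset.exists_ne_zero_of_sum_ne_zero hj
        exact (h.strict _ _ _ (left_ne_zero_of_mul hne)).le.trans
          (hv k (right_ne_zero_of_mul hne)).2
    obtain ⟨w, hw, hfw⟩ := hlow.ex i a f hf (by
      intro j hj
      have hjS := (Finset.mem_filter.1 hj).1
      have e1 : ∑ k ∈ (S (i + 1)).filter (fun j => deg (i + 1) j x < u (Fin.last m) x),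
          d i j k * f k = ∑ k ∈ S (i + 1), d i j k * f k := by
        apply Finset.sum_subset (Finset.filter_subset _ _)
        intro k hk hk'
        by_contra hne
        exact hk' (hf k (right_ne_zero_of_mul hne)).1
      rw [e1]
      have e2 : ∑ k ∈ S (i + 1), d i j k * f k =
          ∑ k ∈ S (i + 1), ∑ l ∈ S (i + 2), (d i j k * d (i + 1) k l) * v l := by
        apply Finset.sum_congr rfl
        intro k hk
        simp only [f, hk, if_true, Finset.mul_sum, mul_assoc]
      rw [e2, Finset.sum_comm]
      apply Finset.sum_eq_zero
      intro l hl
      rw [← Finset.sum_mul, h.dd i j hjS l hl, zero_mul])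
    have hwS : ∀ k, w k ≠ 0 → k ∈ S (i + 2) := fun k hk => (Finset.mem_filter.1 (hw k hk).1).1
    obtain ⟨y, hy, hvy⟩ := h.ex (i + 1) a (v - w) (by
      intro k hk
      by_cases hvk : v k = 0
      · have : w k ≠ 0 := by
          intro hwk; simp [hvk, hwk] at hk
        exact ⟨hwS k this, (hw k this).2⟩
      · exact ⟨hvS k hvk, (hv k hvk).2⟩) (by
      intro j hj
      simp only [Pi.sub_apply, mul_sub, Finset.sum_sub_distrib]
      rw [sub_eq_zero]
      have e3 : ∑ k ∈ S (i + 2), d (i + 1) j k * w k =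
          ∑ k ∈ (S (i + 2)).filter (fun j => deg (i + 2) j x < u (Fin.last m) x),
            d (i + 1) j k * w k := by
        symm
        apply Finset.sum_subset (Finset.filter_subset _ _)
        intro k hk hk'
        by_contra hne
        exact hk' (hw k (right_ne_zero_of_mul hne)).1
      rw [e3]
      by_cases hjx : deg (i + 1) j x < u (Fin.last m) x
      · have := hfw j (Finset.mem_filter.2 ⟨hj, hjx⟩)
        simp only [f, hj, if_true] at this
        exact this
      · rw [hsum, hc j (Finset.mem_filter.2 ⟨hj, not_lt.1 hjx⟩)]
        symm
        apply Finset.sum_eq_zero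
        intro k hk
        by_contra hne
        exact absurd (Finset.mem_filter.1 hk).2
          (not_lt.2 (key _ _ _ (left_ne_zero_of_mul hne) (not_lt.1 hjx))))
    refine ⟨fun l => if u (Fin.last m) x ≤ deg (i + 3) l x then y l else 0, ?_, ?_⟩
    · intro l hl
      by_cases hlx : u (Fin.last m) x ≤ deg (i + 3) l x
      · simp only [hlx, if_true] at hl
        exact ⟨Finset.mem_filter.2 ⟨(hy l hl).1, hlx⟩, (hy l hl).2⟩
      · simp [hlx] at hl
    · intro k hk
      obtain ⟨hkS, hkx⟩ := Finset.mem_filter.1 hk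
      have hwk : w k = 0 := by
        by_contra hne
        exact absurd (Finset.mem_filter.1 (hw k hne).1).2 (not_lt.2 hkx)
      have := hvy k hkS
      rw [Pi.sub_apply, hwk, sub_zero] at this
      rw [this]
      symm
      rw [Finset.sum_filter]
      apply Finset.sum_congr rfl
      intro l hl
      by_cases hlx : u (Fin.last m) x ≤ deg (i + 3) l x
      · simp [hlx]
      · have : d (i + 2) k l = 0 := by
          by_contra hne
          exact hlx (key _ _ _ hne hkx)
        simp [this]
  · intro k hk hd
    obtain ⟨hkS, hkx⟩ := Finset.mem_filter.1 hk
    have hlt := h.strict 1 f0 k hd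
    have hdd := h.dd 0 e0 ((h.S0 _).2 rfl) k hkS
    rw [← Finset.add_sum_erase _ _ hf0] at hdd
    have hne : ∑ j ∈ (S 1).erase f0, d 0 e0 j * d 1 j k ≠ 0 := by
      intro hz
      have hz' : ∑ j ∈ (S (0 + 1)).erase f0, d 0 e0 j * d (0 + 1) j k = 0 := hz
      rw [hz', add_zero] at hdd
      exact mul_ne_zero (h.aug_ne f0 hf0) hd hdd
    obtain ⟨j, hj, hjne⟩ := Finset.exists_ne_zero_of_sum_ne_zero hne
    obtain ⟨hjf, hjS⟩ := Finset.mem_erase.1 hj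
    have hjx : deg 1 j x < u (Fin.last m) x := by
      by_contra hcon
      exact hjf (huniq j hjS (not_lt.1 hcon))
    obtain ⟨g, hg⟩ := hlow.A1 j (Finset.mem_filter.2 ⟨hjS, hjx⟩) (h.aug_ne j hjS)
    refine ⟨g, sup_le (hg.trans (h.strict 1 j k (right_ne_zero_of_mul hjne)).le) ?_⟩
    rw [← hdeg]
    exact hlt.le
  · intro g
    obtain ⟨k', hk', hd', hle'⟩ := h.A2 g.castSucc
    have hne : f0 ≠ k' := by
      rintro rfl
      have h1 := hle' x
      rw [hdeg] at h1
      exact absurd (hx g) (not_lt.2 h1)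
    obtain ⟨v, hv1, hv2, hv3⟩ := h.diff_cycle (u g.castSucc ⊔ u (Fin.last m)) f0 k' hf0 hk' hne
      (hdeg.le.trans le_sup_right) (hle'.trans le_sup_left)
    obtain ⟨w, hw, hvw⟩ := h.ex 0 _ v hv2 hv3
    have h1 := hvw f0 hf0
    rw [hv1] at h1
    obtain ⟨l, hl, hlne⟩ := Finset.exists_ne_zero_of_sum_ne_zero (h1 ▸ one_ne_zero)
    have hdl := left_ne_zero_of_mul hlne
    refine ⟨l, Finset.mem_filter.2 ⟨hl, key _ _ _ hdl (by rw [hdeg])⟩, hdl,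
      (hw l (right_ne_zero_of_mul hlne)).2⟩

theorem main (m : ℕ) : ∀ {ι : ℕ → Type} {S : ∀ i, Finset (ι i)}
    {deg : ∀ i, ι i → σ → ℤ} {d : ∀ i, ι i → ι (i + 1) → K} {e0 : ι 0}
    {u : Fin m → σ → ℤ} (_ : Cx ι S deg d e0 u)
    (_ : ∀ g, ∃ x, deg 0 e0 x < u g x ∧ ∀ k, k ≠ g → u k x < u g x)
    (_ : ∀ g, deg 0 e0 ≤ u g) (L : σ → ℤ) (_ : IsLUB (insert (deg 0 e0) (Set.range u)) L),
    (∀ i, m < i → S i = ∅) ∧ (∃ j, S m = {j} ∧ deg m j = L) ∧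
      ∀ i, i < m → ∀ j ∈ S i, deg i j ≠ L := by
  classical
  induction m with
  | zero =>
    intro ι S deg d e0 u h _ _ L hL
    refine ⟨?_, ⟨e0, ?_, ?_⟩, fun i hi => absurd hi (Nat.not_lt_zero i)⟩
    · intro i hi
      obtain ⟨i, rfl⟩ := Nat.exists_eq_succ_of_ne_zero hi.ne'
      exact h.base i
    · ext j; rw [h.S0, Finset.mem_singleton]
    · rw [Set.range_eq_empty, insert_empty_eq] at hL
      exact isLUB_singleton.unique hL
  | succ m ih =>
    intro ι S deg d e0 u h hdom hle L hL
    obtain ⟨x, hx0, hx⟩ := hdom (Fin.last m)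
    have hx' : ∀ g : Fin m, u g.castSucc x < u (Fin.last m) x :=
      fun g => hx _ (Fin.castSucc_lt_last g).ne
    have hlast : ∀ g : Fin m, ¬ u g.castSucc ≤ u (Fin.last m) := by
      intro g hcon
      obtain ⟨y, _, hy⟩ := hdom g.castSucc
      exact absurd (hcon y) (not_le.2 (hy _ (Fin.castSucc_lt_last g).ne'))
    obtain ⟨f0, hf0, hdeg, huniq⟩ := h.exists_top x hx' hlast
    have hlow := h.lower x hx' hx0
    have hup := h.upper x hx' hx0 f0 hf0 hdeg huniq
    have hLx : u (Fin.last m) x ≤ L x := hL.1 (Set.mem_insert_of_mem _ ⟨_, rfl⟩) x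
    -- the LUB of the lower part
    have low_empty : ∀ i, m < i →
        (S i).filter (fun j => deg i j x < u (Fin.last m) x) = ∅ := by
      have : ∃ L', IsLUB (insert (deg 0 e0) (Set.range fun g : Fin m => u g.castSucc)) L' :=
        ⟨_, Finset.isLUB_sup' (s := insert (deg 0 e0) (Finset.univ.image
          fun g : Fin m => u g.castSucc)) (Finset.insert_nonempty _ _) |> fun h => by
            simpa using h⟩
      obtain ⟨L', hL'⟩ := this
      exact (ih hlow (by
        intro g
        obtain ⟨y, hy0, hy⟩ := hdom g.castSucc
        exact ⟨y, hy0, fun k hk => hy _ (fun hc => hk (Fin.castSucc_injective _ hc))⟩)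
        (fun g => hle _) L' hL').1
    have hup' := ih hup (by
        intro g
        obtain ⟨y, hy0, hy⟩ := hdom g.castSucc
        have hyl := hy _ (Fin.castSucc_lt_last g).ne'
        refine ⟨y, ?_, ?_⟩
        · show deg 1 f0 y < _
          rw [hdeg]
          exact lt_of_lt_of_le hyl le_sup_left
        · intro k hk
          have := hy _ (fun hc => hk (Fin.castSucc_injective _ hc))
          show max _ _ < max _ _
          exact lt_of_lt_of_le (max_lt this hyl) (le_max_left _ _))
        (fun g => by
          show deg 1 f0 ≤ _
          rw [hdeg]; exact le_sup_right) L (by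
        show IsLUB (insert (deg 1 f0) _) L
        rw [hdeg]
        constructor
        · rintro _ (rfl | ⟨g, rfl⟩)
          · exact hL.1 (Set.mem_insert_of_mem _ ⟨_, rfl⟩)
          · exact sup_le (hL.1 (Set.mem_insert_of_mem _ ⟨_, rfl⟩))
              (hL.1 (Set.mem_insert_of_mem _ ⟨_, rfl⟩))
        · intro b hb
          have hbl : u (Fin.last m) ≤ b := hb (Set.mem_insert _ _)
          apply hL.2
          rintro _ (rfl | ⟨g, rfl⟩)
          · exact (hle _).trans hbl
          · induction g using Fin.lastCases with
            | last => exact hbl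
            | cast g =>
              exact le_sup_left.trans (hb (Set.mem_insert_of_mem _ ⟨g, rfl⟩)))
    obtain ⟨hA, ⟨j, hj, hjL⟩, hB⟩ := hup'
    have split : ∀ i, m < i → ∀ k ∈ S i, u (Fin.last m) x ≤ deg i k x := by
      intro i hi k hk
      by_contra hcon
      have : k ∈ (S i).filter (fun j => deg i j x < u (Fin.last m) x) :=
        Finset.mem_filter.2 ⟨hk, not_le.1 hcon⟩
      rw [low_empty i hi] at this
      simp at this
    refine ⟨?_, ⟨j, ?_, hjL⟩, ?_⟩
    · intro i hi
      obtain ⟨i, rfl⟩ := Nat.exists_eq_succ_of_ne_zero (Nat.ne_zero_of_lt hi)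
      rw [Finset.eq_empty_iff_forall_notMem]
      intro k hk
      have h1 := hA i (by omega)
      have : k ∈ (S (i + 1)).filter (fun j => u (Fin.last m) x ≤ deg (i + 1) j x) :=
        Finset.mem_filter.2 ⟨hk, split _ (by omega) k hk⟩
      rw [h1] at this
      simp at this
    · rw [← hj]
      exact (Finset.filter_true_of_mem (split (m + 1) (by omega))).symm
    · intro i hi k hk hkL
      cases i with
      | zero =>
        rw [h.S0] at hk
        subst hk
        rw [hkL] at hx0
        exact absurd hx0 (not_lt.2 hLx)
      | succ i =>
        exact hB i (by omega) k (Finset.mem_filter.2 ⟨hk, by rw [hkL]; exact hLx⟩) hkL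

end Cx

/-- Evaluation at `(1,…,1)`. -/
noncomputable def ev1 (K : Type) [Field K] (n : ℕ) : MvPolynomial (Fin n) K →+* K :=
  MvPolynomial.eval (fun _ => (1 : K))

theorem ev1_monomial {K : Type} [Field K] {n : ℕ} (s : Fin n →₀ ℕ) (c : K) :
    ev1 K n (monomial s c) = c := by
  simp [ev1, MvPolynomial.eval_monomial, Finsupp.prod]

theorem homog_eq {K : Type} [Field K] {n : ℕ} (p : MvPolynomial (Fin n) K)
    (c e : Fin n →₀ ℕ) (hp : ∀ s ∈ p.support, c + s = e) :
    p = 0 ∨ ∃ s r, c + s = e ∧ r ≠ 0 ∧ p = monomial s r := by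
  by_cases h0 : p = 0
  · exact Or.inl h0
  right
  obtain ⟨s, hs⟩ := MvPolynomial.support_nonempty.2 h0
  refine ⟨s, coeff s p, hp s hs, MvPolynomial.mem_support_iff.1 hs, ?_⟩
  ext t
  rw [coeff_monomial]
  split_ifs with hst
  · rw [hst]
  · by_contra hne
    have := hp t (MvPolynomial.mem_support_iff.2 hne)
    exact hst (add_left_cancel ((hp s hs).trans this.symm))

theorem homog_zero {K : Type} [Field K] {n : ℕ} (p : MvPolynomial (Fin n) K)
    (c e : Fin n →₀ ℕ) (hp : ∀ s ∈ p.support, c + s = e) (h : ev1 K n p = 0) : p = 0 := by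
  rcases homog_eq p c e hp with h0 | ⟨s, r, _, hr, rfl⟩
  · exact h0
  · rw [ev1_monomial] at h
    exact absurd h hr

theorem coeff_homog_mul {K : Type} [Field K] {n : ℕ} (p W : MvPolynomial (Fin n) K)
    (c e b : Fin n →₀ ℕ) (hp : ∀ s ∈ p.support, c + s = e) (hcb : c ≤ b) :
    coeff (b - c) (p * W) = ev1 K n p * (if e ≤ b then coeff (b - e) W else 0) := by
  rcases homog_eq p c e hp with h0 | ⟨s, r, hs, hr, rfl⟩
  · simp [h0]
  · rw [ev1_monomial, coeff_monomial_mul']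
    have : s ≤ b - c ↔ e ≤ b := by
      rw [← hs]
      constructor
      · intro h x
        have h1 : s x ≤ b x - c x := by simpa using h x
        have h2 : c x ≤ b x := hcb x
        simp only [Finsupp.add_apply]
        omega
      · intro h x
        have h1 : c x + s x ≤ b x := by simpa using h x
        simp only [Finsupp.tsub_apply]
        omega
    by_cases he : e ≤ b
    · rw [if_pos (this.2 he), if_pos he, ← hs, tsub_add_eq_tsub_tsub]
    · rw [if_neg (fun h => he (this.1 h)), if_neg he, mul_zero]

/-- exponent vectors as integer vectors -/
def expZ {n : ℕ} (a : Fin n →₀ ℕ) : Fin n → ℤ := fun x => (a x : ℤ)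

theorem expZ_le {n : ℕ} {a b : Fin n →₀ ℕ} : expZ a ≤ expZ b ↔ a ≤ b := by
  constructor
  · intro h x
    have : (a x : ℤ) ≤ b x := h x
    exact_mod_cast this
  · intro h x
    show (a x : ℤ) ≤ b x
    exact_mod_cast h x

theorem expZ_inj {n : ℕ} {a b : Fin n →₀ ℕ} : expZ a = expZ b ↔ a = b := by
  rw [le_antisymm_iff, expZ_le, expZ_le, ← le_antisymm_iff]

theorem exact_conv {K : Type} [Field K] {n : ℕ} {α β γ : Type} [Fintype α] [Fintype β] [Fintype γ]
    (A : Matrix α β (MvPolynomial (Fin n) K)) (B : Matrix β γ (MvPolynomial (Fin n) K))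
    (dα : α → Fin n →₀ ℕ) (dβ : β → Fin n →₀ ℕ) (dγ : γ → Fin n →₀ ℕ)
    (hA : ∀ j k, ∀ s ∈ (A j k).support, dα j + s = dβ k)
    (hB : ∀ j k, ∀ s ∈ (B j k).support, dβ j + s = dγ k)
    (hex : ∀ V, A.mulVec V = 0 → ∃ W, B.mulVec W = V)
    (a : Fin n → ℤ) (v : β → K) (hv : ∀ k, v k ≠ 0 → expZ (dβ k) ≤ a)
    (hc : ∀ j, ∑ k, ev1 K n (A j k) * v k = 0) :
    ∃ w : γ → K, (∀ l, w l ≠ 0 → expZ (dγ l) ≤ a) ∧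
      ∀ k, v k = ∑ l, ev1 K n (B k l) * w l := by
  classical
  by_cases hv0 : ∀ k, v k = 0
  · exact ⟨0, fun l hl => absurd rfl hl, fun k => by simp [hv0 k]⟩
  push Not at hv0
  obtain ⟨k0, hk0⟩ := hv0
  obtain ⟨b, rfl⟩ : ∃ b : Fin n →₀ ℕ, a = expZ b := by
    refine ⟨Finsupp.equivFunOnFinite.symm fun x => (a x).toNat, ?_⟩
    funext x
    have : ((dβ k0 x : ℕ) : ℤ) ≤ a x := hv k0 hk0 x
    simp only [expZ, Finsupp.equivFunOnFinite_symm_apply_apply]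
    omega
  simp only [expZ_le] at hv ⊢
  let V : β → MvPolynomial (Fin n) K := fun k => monomial (b - dβ k) (v k)
  obtain ⟨W, hW⟩ := hex V (by
    funext j
    show ∑ k, A j k * V k = 0
    apply homog_zero _ (dα j) b
    · intro s hs
      rw [MvPolynomial.mem_support_iff, coeff_sum] at hs
      obtain ⟨k, _, hk⟩ := Finset.exists_ne_zero_of_sum_ne_zero hs
      rw [coeff_mul_monomial'] at hk
      by_cases hle : b - dβ k ≤ s
      · rw [if_pos hle] at hk
        have h1 := hA j k _ (MvPolynomial.mem_support_iff.2 (left_ne_zero_of_mul hk))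
        have h2 := hv k (right_ne_zero_of_mul hk)
        ext x
        have h1x := DFunLike.congr_fun h1 x
        have h2x := h2 x
        have h3x := hle x
        simp only [Finsupp.add_apply, Finsupp.tsub_apply] at h1x h2x h3x ⊢
        omega
      · rw [if_neg hle] at hk
        exact absurd rfl hk
    · rw [map_sum]
      simp only [map_mul, V, ev1_monomial]
      exact hc j)
  refine ⟨fun l => if dγ l ≤ b then coeff (b - dγ l) (W l) else 0, ?_, ?_⟩
  · intro l hl
    by_contra hcon
    simp [hcon] at hl
  · intro k
    by_cases hk : dβ k ≤ b
    · have h1 : coeff (b - dβ k) (∑ l, B k l * W l) = coeff (b - dβ k) (V k) := by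
        rw [← hW]; rfl
      rw [coeff_sum] at h1
      simp only [V, coeff_monomial, if_true] at h1
      rw [← h1]
      apply Finset.sum_congr rfl
      intro l _
      exact coeff_homog_mul _ _ _ _ _ (hB k l) hk
    · have hvk : v k = 0 := by
        by_contra hne
        exact hk (hv k hne)
      rw [hvk]
      symm
      apply Finset.sum_eq_zero
      intro l _
      rcases homog_eq _ _ _ (hB k l) with h0 | ⟨s, r, hs, _, _⟩
      · simp [h0]
      · suffices hz : ¬ dγ l ≤ b by
          simp only [hz, if_false, mul_zero]
        intro hl
        apply hk
        refine le_trans ?_ hl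
        rw [← hs]
        exact le_self_add

namespace MinFreeRes

variable {K : Type} [Field K] {n : ℕ} {I : Ideal (MvPolynomial (Fin n) K)} (F : MinFreeRes I)

/-- ranks of the augmented complex -/
def rkA : ℕ → ℕ
  | 0 => 1
  | i + 1 => F.rk i

/-- degrees of the augmented complex -/
def degA : (i : ℕ) → Fin (F.rkA i) → Fin n → ℤ
  | 0 => fun _ _ => -1
  | i + 1 => fun j => expZ (F.deg i j)

/-- row matrix of the augmentation -/
noncomputable def augM : Matrix (Fin 1) (Fin (F.rk 0)) (MvPolynomial (Fin n) K) :=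
  fun _ k => F.aug (Pi.single k 1)

/-- scalar differentials of the augmented complex -/
noncomputable def dA : (i : ℕ) → Fin (F.rkA i) → Fin (F.rkA (i + 1)) → K
  | 0 => fun j k => ev1 K n (F.augM j k)
  | i + 1 => fun j k => ev1 K n (F.d i j k)

theorem aug_eq (V : Fin (F.rk 0) → MvPolynomial (Fin n) K) :
    F.aug V = ∑ k, F.augM 0 k * V k := by
  classical
  conv_lhs => rw [pi_eq_sum_univ' V]
  rw [map_sum]
  apply Finset.sum_congr rfl
  intro k _
  rw [map_smul, smul_eq_mul, mul_comm]
  congr 2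

theorem augM_mulVec (V : Fin (F.rk 0) → MvPolynomial (Fin n) K) :
    F.augM.mulVec V = 0 ↔ F.aug V = 0 := by
  rw [aug_eq]
  constructor
  · intro h
    exact congrFun h 0
  · intro h
    funext j
    rw [Subsingleton.elim j 0]
    exact h

theorem augM_homog (j : Fin 1) (k) : ∀ s ∈ (F.augM j k).support, (0 : Fin n →₀ ℕ) + s = F.deg 0 k := by
  intro s hs
  rw [zero_add]
  simpa using F.aug_homog k hs

theorem exact0 (V) : F.augM.mulVec V = 0 ↔ ∃ W, (F.d 0).mulVec W = V := by
  rw [augM_mulVec, ← LinearMap.mem_ker, ← F.exact_zero]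
  rfl

theorem exactS (i V) : (F.d i).mulVec V = 0 ↔ ∃ W, (F.d (i + 1)).mulVec W = V := by
  have : (F.d i).mulVec V = 0 ↔ V ∈ LinearMap.ker (Matrix.mulVecLin (F.d i)) := by
    rw [LinearMap.mem_ker]; rfl
  rw [this, ← F.exact_succ]
  rfl

theorem dd_conv {α β γ : Type} [Fintype α] [Fintype β] [Fintype γ] [DecidableEq γ]
    (A : Matrix α β (MvPolynomial (Fin n) K)) (B : Matrix β γ (MvPolynomial (Fin n) K))
    (h : ∀ W, A.mulVec (B.mulVec W) = 0) (j : α) (l : γ) :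
    ∑ k, ev1 K n (A j k) * ev1 K n (B k l) = 0 := by
  have h1 := congrFun (h (Pi.single l 1)) j
  rw [Matrix.mulVec_mulVec, Matrix.mulVec_single_one] at h1
  have h2 : ∑ k, A j k * B k l = 0 := h1
  have h3 := congrArg (ev1 K n) h2
  simpa using h3

theorem toCx {m : ℕ} (hn : 0 < n) (u : Fin m → (Fin n →₀ ℕ))
    (hI : I = Ideal.span (Set.range fun j => monomial (u j) (1 : K))) :
    Cx (fun i => Fin (F.rkA i)) (fun _ => Finset.univ) F.degA F.dA (0 : Fin 1)
      (fun g => expZ (u g)) := by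
  classical
  refine ⟨?_, ?_, ?_, ?_, ?_, ?_⟩
  · intro j
    exact ⟨fun _ => Subsingleton.elim (α := Fin 1) _ _, fun _ => Finset.mem_univ _⟩
  · intro i j k hd
    cases i with
    | zero =>
      rw [Pi.lt_def]
      refine ⟨fun x => ?_, ⟨0, hn⟩, ?_⟩
      · show (-1 : ℤ) ≤ (F.deg 0 k x : ℤ)
        omega
      · show (-1 : ℤ) < (F.deg 0 k _ : ℤ)
        omega
    | succ i =>
      change ev1 K n (F.d i j k) ≠ 0 at hd
      rcases homog_eq _ _ _ (F.d_homog i j k) with h0 | ⟨s, r, hs, hr, hp⟩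
      · rw [h0, map_zero] at hd; exact absurd rfl hd
      · have hs0 : s ≠ 0 := by
          rintro rfl
          have := F.minimal i j k
          rw [hp, coeff_monomial, if_pos rfl] at this
          exact hr this
        show expZ (F.deg i j) < expZ (F.deg (i + 1) k)
        rw [lt_iff_le_and_ne, expZ_le, Ne, expZ_inj, ← hs]
        exact ⟨le_self_add, fun hc => hs0 (by simpa using hc)⟩
  · intro i j _ l _
    cases i with
    | zero => exact dd_conv F.augM (F.d 0) (fun W => (F.exact0 _).2 ⟨W, rfl⟩) j l
    | succ i => exact dd_conv (F.d i) (F.d (i + 1)) (fun W => (F.exactS i _).2 ⟨W, rfl⟩) j l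
  · intro i a v hv hc
    cases i with
    | zero =>
      obtain ⟨w, h1, h2⟩ := exact_conv F.augM (F.d 0) (fun _ => 0) (F.deg 0) (F.deg 1)
        F.augM_homog (F.d_homog 0) (fun V => (F.exact0 V).1) a v (fun k hk => (hv k hk).2)
        (fun j => hc j (Finset.mem_univ _))
      exact ⟨w, fun l hl => ⟨Finset.mem_univ _, h1 l hl⟩, fun k _ => h2 k⟩
    | succ i =>
      obtain ⟨w, h1, h2⟩ := exact_conv (F.d i) (F.d (i + 1)) (F.deg i) (F.deg (i + 1))
        (F.deg (i + 2)) (F.d_homog i) (F.d_homog (i + 1)) (fun V => (F.exactS i V).1) a v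
        (fun k hk => (hv k hk).2) (fun j => hc j (Finset.mem_univ _))
      exact ⟨w, fun l hl => ⟨Finset.mem_univ _, h1 l hl⟩, fun k _ => h2 k⟩
  · intro k _ hd
    change ev1 K n (F.augM 0 k) ≠ 0 at hd
    rcases homog_eq _ _ _ (F.augM_homog 0 k) with h0 | ⟨s, r, hs, hr, hp⟩
    · rw [h0, map_zero] at hd; exact absurd rfl hd
    · have hmem : F.augM 0 k ∈ I := (F.range_aug _).1 ⟨_, rfl⟩
      have hI' : I = Ideal.span ((fun a => monomial a (1 : K)) '' Set.range u) := by
        rw [hI, ← Set.range_comp]; rfl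
      generalize F.augM 0 k = q at hmem hp
      rw [hI', MvPolynomial.mem_ideal_span_monomial_image] at hmem
      obtain ⟨_, ⟨g, rfl⟩, hg⟩ := hmem s (by
        rw [hp, MvPolynomial.mem_support_iff, coeff_monomial, if_pos rfl]; exact hr)
      rw [zero_add] at hs
      refine ⟨g, ?_⟩
      show expZ (u g) ≤ expZ (F.deg 0 k)
      rw [expZ_le, ← hs]
      exact hg
  · intro g
    have hmem : monomial (u g) (1 : K) ∈ I := by
      rw [hI]; exact Ideal.subset_span ⟨g, rfl⟩
    obtain ⟨V, hV⟩ := (F.range_aug _).2 hmem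
    have h1 : coeff (u g - 0) (F.aug V) = 1 := by
      rw [hV, tsub_zero, coeff_monomial, if_pos rfl]
    rw [aug_eq, coeff_sum] at h1
    obtain ⟨k, _, hk⟩ := Finset.exists_ne_zero_of_sum_ne_zero (h1 ▸ one_ne_zero)
    rw [coeff_homog_mul _ _ _ _ _ (F.augM_homog 0 k) zero_le] at hk
    refine ⟨k, Finset.mem_univ _, left_ne_zero_of_mul hk, ?_⟩
    show expZ (F.deg 0 k) ≤ expZ (u g)
    rw [expZ_le]
    by_contra hcon
    rw [if_neg hcon] at hk
    simp at hk

end MinFreeRes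

/-- If the minimal generators `u_1,…,u_m` (monomials) of `I ⊆ K[x_1,…,x_n]` form a
dominant set (each generator has a variable whose exponent strictly exceeds its
exponent in every other generator), then `pdim I = m - 1`, the top multigraded Betti
number `β_{m-1,a}(I)` is `1` at `a = lcm(u_1,…,u_m)` and `0` otherwise, and
`β_{i,b}(I) = 0` for `i ≠ m-1` where `x^b = lcm(u_1,…,u_m)`. -/
theorem stmt12 {K : Type} [Field K] (n m : ℕ) (hm : 0 < m)
    (u : Fin m → (Fin n →₀ ℕ))
    (I : Ideal (MvPolynomial (Fin n) K))
    (hI : I = Ideal.span (Set.range fun j => monomial (u j) (1 : K)))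
    (hdom : ∀ j, ∃ x : Fin n, ∀ k, k ≠ j → u k x < u j x)
    (L : Fin n →₀ ℕ)
    (hL : L = Finsupp.equivFunOnFinite.symm fun x => Finset.univ.sup fun j => u j x)
    (F : MinFreeRes I) :
    F.IsPdim (m - 1) ∧ (∀ a, F.cnt (m - 1) a = if a = L then 1 else 0) ∧
      ∀ i, i ≠ m - 1 → F.cnt i L = 0 := by
  classical
  obtain ⟨m, rfl⟩ := Nat.exists_eq_succ_of_ne_zero hm.ne'
  have hn : 0 < n := by
    obtain ⟨x, _⟩ := hdom 0
    exact x.pos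
  have hLub : ∀ b : Fin n → ℤ, expZ L ≤ b ↔ ∀ g, expZ (u g) ≤ b := by
    intro b
    have hLx : ∀ x, L x = Finset.univ.sup fun j => u j x := by
      intro x; rw [hL]; rfl
    constructor
    · intro h g x
      have h1 : (L x : ℤ) ≤ b x := h x
      have h2 : u g x ≤ L x := by
        rw [hLx]; exact Finset.le_sup (f := fun j => u j x) (Finset.mem_univ g)
      show (u g x : ℤ) ≤ b x
      omega
    · intro h x
      show (L x : ℤ) ≤ b x
      have h0 : ((u 0 x : ℕ) : ℤ) ≤ b x := h 0 x
      have : L x ≤ (b x).toNat := by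
        rw [hLx]
        apply Finset.sup_le
        intro g _
        have hg : ((u g x : ℕ) : ℤ) ≤ b x := h g x
        omega
      omega
  have hneg : ∀ g, F.degA 0 (0 : Fin 1) ≤ expZ (u g) := by
    intro g x
    show (-1 : ℤ) ≤ (u g x : ℤ)
    omega
  obtain ⟨hA, ⟨j, hj, hjL⟩, hB⟩ := Cx.main (m + 1) (F.toCx hn u hI) (by
      intro g
      obtain ⟨x, hx⟩ := hdom g
      refine ⟨x, ?_, ?_⟩
      · show (-1 : ℤ) < (u g x : ℤ)
        omega
      · intro k hk
        show (u k x : ℤ) < (u g x : ℤ)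
        exact_mod_cast hx k hk) hneg (expZ L) (by
      constructor
      · rintro _ (rfl | ⟨g, rfl⟩)
        · exact (hneg 0).trans ((hLub _).1 le_rfl 0)
        · exact (hLub _).1 le_rfl g
      · intro b hb
        exact (hLub b).2 fun g => hb (Set.mem_insert_of_mem _ ⟨g, rfl⟩))
  have hA' : ∀ i, m < i → F.rk i = 0 := by
    intro i hi
    have h1 := hA (i + 1) (by omega)
    have h2 := congrArg Finset.card h1
    rw [Finset.card_univ, Fintype.card_fin] at h2
    exact h2
  change Fin (F.rk m) at j
  have hjL' : F.deg m j = L := expZ_inj.1 hjL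
  have hju : ∀ j' : Fin (F.rk m), j' = j := by
    intro j'
    have : j' ∈ (Finset.univ : Finset (Fin (F.rkA (m + 1)))) := Finset.mem_univ (α := Fin (F.rk m)) j'
    rw [hj] at this
    exact Finset.mem_singleton.1 this
  have hB' : ∀ i, i < m → ∀ k, F.deg i k ≠ L := by
    intro i hi k hk
    exact hB (i + 1) (by omega) k (Finset.mem_univ _) (expZ_inj.2 hk)
  simp only [Nat.succ_eq_add_one, Nat.add_sub_cancel]
  refine ⟨⟨(Fin.pos j).ne', hA'⟩, ?_, ?_⟩
  · intro a
    unfold MinFreeRes.cnt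
    split_ifs with ha
    · subst ha
      rw [Nat.card_eq_one_iff_unique]
      exact ⟨⟨fun x y => Subtype.ext ((hju _).trans (hju _).symm)⟩, ⟨⟨j, hjL'⟩⟩⟩
    · rw [Nat.card_eq_zero]
      left
      refine ⟨fun x => ha ?_⟩
      rw [← x.2, hju x.1, hjL']
  · intro i hi
    unfold MinFreeRes.cnt
    rw [Nat.card_eq_zero]
    left
    refine ⟨fun x => ?_⟩
    rcases lt_or_gt_of_ne hi with h | h
    · exact hB' i h x.1 x.2
    · have h1 := x.1.pos
      rw [hA' i h] at h1
      exact absurd h1 (lt_irrefl _)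
end

section
/- Let K_{s,t} be the weighted oriented complete bipartite graph with vertices x_1,...,x_s, y_1,...,y_t, all edges oriented from x_i to y_j, and weights w_1,...,w_t on the y-vertices. Its edge ideal J_{s,t} = (x_i y_j^{w_j} : 1 ≤ i ≤ s, 1 ≤ j ≤ t) has projective dimension s + t − 2, and its top multigraded Betti number β_{s+t-2,α}(J_{s,t}) equals 1 if x^α = x_1···x_s·y_1^{w_1}···y_t^{w_t} and 0 otherwise. -/
open MvPolynomial

section ExtPart
open CategoryTheory CategoryTheory.Abelian

variable {R : Type} [CommRing R]

lemma conn_equiv (N : ModuleCat.{0} R) {S : ShortComplex (ModuleCat.{0} R)} (hS : S.ShortExact)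
    (i : ℕ) (h0 : ∀ x : Ext S.X₂ N i, (Ext.mk₀ S.f).comp x (zero_add i) = 0)
    (h1 : ∀ x : Ext S.X₂ N (i+1), x = 0) :
    Nonempty (Ext S.X₁ N i ≃ₗ[R] Ext S.X₃ N (i+1)) := by
  refine ⟨LinearEquiv.ofBijective (Ext.precompOfLinear hS.extClass R N (add_comm 1 i)) ⟨?_, ?_⟩⟩
  · rw [← LinearMap.ker_eq_bot, LinearMap.ker_eq_bot']
    intro x hx
    obtain ⟨y, rfl⟩ := Ext.contravariant_sequence_exact₁ hS N x (add_comm 1 i) hx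
    exact h0 y
  · intro x
    obtain ⟨y, hy⟩ := Ext.contravariant_sequence_exact₃ hS N x (h1 _) (add_comm 1 i)
    exact ⟨y, hy⟩

lemma conn_vanish (N : ModuleCat.{0} R) {S : ShortComplex (ModuleCat.{0} R)} (hS : S.ShortExact)
    (i : ℕ) (h0 : ∀ x : Ext S.X₁ N i, x = 0)
    (h1 : ∀ x : Ext S.X₂ N (i+1), x = 0) (x : Ext S.X₃ N (i+1)) : x = 0 := by
  obtain ⟨y, rfl⟩ := Ext.contravariant_sequence_exact₃ hS N x (h1 _) (add_comm 1 i)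
  rw [h0 y, Ext.comp_zero]

lemma smul_ext_zero (N M : ModuleCat.{0} R) (r : R) (hr : ∀ x : N, r • x = 0) (i : ℕ)
    (x : Ext M N i) : r • x = 0 := by
  rw [Ext.smul_eq_comp_mk₀]
  have : r • 𝟙 N = 0 := by
    ext x
    exact hr x
  rw [this, Ext.mk₀_zero, Ext.comp_zero]

/-- top Ext -/
def TopExt (N M : ModuleCat.{0} R) (d : ℕ) : Prop :=
  Nonempty (Ext M N d ≃ₗ[R] N) ∧ ∀ i, d < i → ∀ x : Ext M N i, x = 0

noncomputable def extCongr (N : ModuleCat.{0} R) {M M' : ModuleCat.{0} R} (e : M ≅ M') (i : ℕ) :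
    Ext M N i ≃ₗ[R] Ext M' N i :=
  LinearEquiv.ofLinearMap (Ext.precompOfLinear (Ext.mk₀ e.inv) R N (zero_add i))
    (Ext.precompOfLinear (Ext.mk₀ e.hom) R N (zero_add i))
    (by ext x; simp) (by ext x; simp)

lemma TopExt.congr {N M M' : ModuleCat.{0} R} (e : M ≅ M') {d : ℕ} (h : TopExt N M d) :
    TopExt N M' d := by
  obtain ⟨⟨f⟩, h⟩ := h
  refine ⟨⟨(extCongr N e d).symm.trans f⟩, fun i hi x => ?_⟩
  apply (extCongr N e i).symm.injective
  exact (h i hi _).trans (h i hi _).symm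

lemma ext_prod_zero (N : ModuleCat.{0} R) (A B : Type) [AddCommGroup A] [Module R A]
    [AddCommGroup B] [Module R B] (i : ℕ) (hA : ∀ x : Ext (ModuleCat.of R A) N i, x = 0)
    (hB : ∀ x : Ext (ModuleCat.of R B) N i, x = 0) (x : Ext (ModuleCat.of R (A × B)) N i) :
    x = 0 := by
  have : 𝟙 (ModuleCat.of R (A × B)) =
      ModuleCat.ofHom (LinearMap.fst R A B) ≫ ModuleCat.ofHom (LinearMap.inl R A B) +
      ModuleCat.ofHom (LinearMap.snd R A B) ≫ ModuleCat.ofHom (LinearMap.inr R A B) := by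
    ext x <;> simp
  rw [← Ext.mk₀_id_comp x, this, Ext.mk₀_add, Ext.add_comp, ← Ext.mk₀_comp_mk₀,
    ← Ext.mk₀_comp_mk₀, Ext.comp_assoc_of_second_deg_zero, Ext.comp_assoc_of_second_deg_zero,
    hA (Ext.comp _ x _), hB (Ext.comp _ x _)]
  simp

lemma topExt_step (N : ModuleCat.{0} R) (A B B' : Ideal R) (r : R) (hr : ∀ x : N, r • x = 0)
    (hBA : B ≤ A) (hreg : ∀ a ∈ A, r * a ∈ B → a ∈ B) (hB' : B' = B ⊔ Ideal.span {r} * A) (d : ℕ)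
    (hB : TopExt N (ModuleCat.of R B) d)
    (hA : ∀ i, d < i → ∀ x : Ext (ModuleCat.of R A) N i, x = 0)
    (hres : ∀ x : Ext (ModuleCat.of R A) N d,
      (Ext.mk₀ (ModuleCat.ofHom (Submodule.inclusion hBA))).comp x (zero_add d) = 0) :
    TopExt N (ModuleCat.of R B') (d + 1) := by
  have h1 : B ≤ B' := hB' ▸ le_sup_left
  have h2 : ∀ a ∈ A, r * a ∈ B' := fun a ha => by
    rw [hB']
    exact Ideal.mem_sup_right (Ideal.mul_mem_mul (Ideal.mem_span_singleton_self r) ha)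
  let f : B →ₗ[R] B × A := LinearMap.prod (r • LinearMap.id) (-(Submodule.inclusion hBA))
  let m : A →ₗ[R] B' := LinearMap.codRestrict B' (r • A.subtype) (fun a => h2 a a.2)
  let g : B × A →ₗ[R] B' := LinearMap.coprod (Submodule.inclusion h1) m
  have hfg : g ∘ₗ f = 0 := by
    ext b
    change r * (b : R) + r * (-(b : R)) = 0
    ring
  let S : ShortComplex (ModuleCat.{0} R) := ShortComplex.mk (ModuleCat.ofHom f) (ModuleCat.ofHom g)
    (by rw [← ModuleCat.ofHom_comp, hfg]; rfl)
  have hS : S.ShortExact := by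
    refine ModuleCat.shortComplex_shortExact S ?_ ?_ ?_
    · rintro ⟨⟨b, hb⟩, ⟨a, ha⟩⟩
      constructor
      · intro h
        have h' : b + r * a = 0 := congrArg Subtype.val h
        have hab : a ∈ B := hreg a ha (by
          have : r * a = -b := by linear_combination h'
          rw [this]
          exact neg_mem hb)
        refine ⟨(⟨-a, neg_mem hab⟩ : B), ?_⟩
        refine Prod.ext (Subtype.ext ?_) (Subtype.ext ?_)
        · change r * (-a) = b
          linear_combination -h'
        · change -(-a) = a
          ring
      · rintro ⟨b, h⟩
        rw [← h]
        exact LinearMap.congr_fun hfg b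
    · intro b b' h
      have : -((b : B) : R) = -((b' : B) : R) := congrArg (fun x : B × A => (x.2 : R)) h
      exact Subtype.ext (neg_injective this)
    · rintro ⟨b, hb⟩
      have hb2 := hb
      rw [hB', Submodule.mem_sup] at hb2
      obtain ⟨y, hy, z, hz, rfl⟩ := hb2
      rw [Ideal.mem_span_singleton_mul] at hz
      obtain ⟨a, ha, rfl⟩ := hz
      exact ⟨((⟨y, hy⟩ : B), (⟨a, ha⟩ : A)), rfl⟩
  have hz : ∀ i, d < i → ∀ x : Ext S.X₂ N i, x = 0 := fun i hi x =>
    ext_prod_zero N B A i (hB.2 i hi) (hA i hi) x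
  refine ⟨?_, ?_⟩
  · have h0 : ∀ x : Ext S.X₂ N d, (Ext.mk₀ S.f).comp x (zero_add d) = 0 := by
      intro x
      have : S.f = r • ModuleCat.ofHom (LinearMap.inl R B A) - 
          ModuleCat.ofHom (Submodule.inclusion hBA) ≫ ModuleCat.ofHom (LinearMap.inr R B A) := by
        ext b <;> simp [S, f]
      rw [this, sub_eq_add_neg, Ext.mk₀_add, Ext.add_comp, Ext.mk₀_smul, Ext.smul_comp,
        smul_ext_zero N _ r hr, Ext.mk₀_neg, Ext.neg_comp, ← Ext.mk₀_comp_mk₀,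
        Ext.comp_assoc_of_second_deg_zero, hres]
      simp
    obtain ⟨e⟩ := conn_equiv N hS d h0 (hz _ (Nat.lt_succ_self d))
    obtain ⟨e'⟩ := hB.1
    exact ⟨e.symm.trans e'⟩
  · intro i hi
    obtain ⟨i, rfl⟩ : ∃ j, i = j + 1 := ⟨i - 1, by omega⟩
    exact conn_vanish N hS i (hB.2 i (by omega)) (hz (i+1) (by omega))

lemma topExt_base [IsDomain R] (N : ModuleCat.{0} R) (A B : Ideal R) (r : R) (hr0 : r ≠ 0)
    (hr : ∀ x : N, r • x = 0)
    (hBA : B ≤ A) (hB : B = Ideal.span {r} * A) (d : ℕ)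
    (hA : TopExt N (ModuleCat.of R A) d) :
    TopExt N (ModuleCat.of R B) d ∧
    ∀ i, ∀ x : Ext (ModuleCat.of R A) N i,
      (Ext.mk₀ (ModuleCat.ofHom (Submodule.inclusion hBA))).comp x (zero_add i) = 0 := by
  let m : A →ₗ[R] B := LinearMap.codRestrict B (r • A.subtype) (fun a => by
    rw [hB]
    exact (Ideal.mul_mem_mul (Ideal.mem_span_singleton_self r) a.2))
  have hm : Function.Bijective m := by
    constructor
    · intro a b hab
      have := congrArg Subtype.val hab
      simpa [m, hr0] using this
    · rintro ⟨b, hb⟩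
      rw [hB, Ideal.mem_span_singleton_mul] at hb
      obtain ⟨a, ha, hab⟩ := hb
      exact ⟨⟨a, ha⟩, Subtype.ext hab⟩
  let e := LinearEquiv.ofBijective m hm
  refine ⟨hA.congr e.toModuleIso, fun i x => ?_⟩
  have : ModuleCat.ofHom (Submodule.inclusion hBA) = r • ModuleCat.ofHom e.symm.toLinearMap := by
    ext b
    obtain ⟨a, rfl⟩ := e.surjective b
    simp
    simp [e, m]
  rw [this, Ext.mk₀_smul, Ext.smul_comp, smul_ext_zero N _ r hr]

lemma topExt_top (N : ModuleCat.{0} R) : TopExt N (ModuleCat.of R (⊤ : Ideal R)) 0 := by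
  refine TopExt.congr (M := ModuleCat.of R R) (Submodule.topEquiv.symm.toModuleIso) ⟨?_, ?_⟩
  · refine ⟨Ext.linearEquiv₀.trans ((ModuleCat.homLinearEquiv (S := R)).trans (LinearMap.ringLmapEquivSelf R R N))⟩
  · intro i hi x
    obtain ⟨i, rfl⟩ : ∃ j, i = j + 1 := ⟨i - 1, by omega⟩
    exact Ext.eq_zero_of_projective x

lemma topExt_chain [IsDomain R] (N : ModuleCat.{0} R) (A : Ideal R) (e : ℕ)
    (hA : TopExt N (ModuleCat.of R A) e) (d : ℕ) (r : ℕ → R)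
    (hr0 : ∀ k < d + 1, r k ≠ 0) (hr : ∀ k < d + 1, ∀ x : N, r k • x = 0)
    (hreg : ∀ k < d + 1, ∀ a ∈ A, r k * a ∈ Ideal.span (r '' {l | l < k}) * A →
      a ∈ Ideal.span (r '' {l | l < k}) * A) :
    TopExt N (ModuleCat.of R ↥(Ideal.span (r '' {l | l < d + 1}) * A : Ideal R)) (e + d) ∧
    ∀ x : Ext (ModuleCat.of R A) N (e + d),
      (Ext.mk₀ (ModuleCat.ofHom (Submodule.inclusion (Ideal.mul_le_right :
        Ideal.span (r '' {l | l < d + 1}) * A ≤ A)))).comp x (zero_add (e + d)) = 0 := by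
  induction d with
  | zero =>
    have h := topExt_base N A (Ideal.span (r '' {l | l < 0 + 1}) * A) (r 0) (hr0 0 (by simp))
      (hr 0 (by simp)) Ideal.mul_le_right (by simp) e hA
    exact ⟨h.1, h.2 _⟩
  | succ d ih =>
    obtain ⟨h1, h2⟩ := ih (fun k hk => hr0 k (by omega)) (fun k hk => hr k (by omega))
      (fun k hk => hreg k (by omega))
    refine ⟨?_, ?_⟩
    · refine topExt_step N A _ _ (r (d+1)) (hr (d+1) (by omega)) Ideal.mul_le_right
        (hreg (d+1) (by omega)) ?_ (e + d) h1 (fun i hi => hA.2 i (by omega)) h2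
      rw [← Ideal.sup_mul, ← Ideal.span_union]
      congr 2
      ext x
      simp only [Set.mem_image, Set.mem_ofPred_eq, Set.mem_union, Set.mem_singleton_iff]
      constructor
      · rintro ⟨l, hl, rfl⟩
        rcases Nat.lt_succ_iff_lt_or_eq.1 hl with h | h
        · exact Or.inl ⟨l, h, rfl⟩
        · exact Or.inr (by rw [h])
      · rintro (⟨l, hl, rfl⟩ | rfl)
        · exact ⟨l, by omega, rfl⟩
        · exact ⟨d+1, by omega, rfl⟩
    · intro x
      rw [hA.2 (e + (d+1)) (by omega) x, Ext.comp_zero]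

lemma shift_equiv (N : ModuleCat.{0} R) {F M : Type} [AddCommGroup F] [Module R F]
    [AddCommGroup M] [Module R M] [Module.Projective R F] (g : F →ₗ[R] M)
    (hg : Function.Surjective g) (Z : Submodule R F) (hZ : Z = LinearMap.ker g)
    (h0 : ∀ φ : F →ₗ[R] N, ∀ z ∈ Z, φ z = 0) (i : ℕ) :
    Nonempty (Ext (ModuleCat.of R Z) N i ≃ₗ[R] Ext (ModuleCat.of R M) N (i+1)) := by
  let S : ShortComplex (ModuleCat.{0} R) := ShortComplex.mk (ModuleCat.ofHom Z.subtype)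
    (ModuleCat.ofHom g)
    (by
      ext z
      have : (z : Z).1 ∈ LinearMap.ker g := hZ ▸ (z : Z).2
      exact this)
  have hS : S.ShortExact := by
    refine ModuleCat.shortComplex_shortExact S ?_ ?_ hg
    · intro x
      constructor
      · intro h
        have h' : x ∈ LinearMap.ker g := h
        exact ⟨(⟨x, hZ ▸ h'⟩ : Z), rfl⟩
      · rintro ⟨z, rfl⟩
        have : (z : Z).1 ∈ LinearMap.ker g := hZ ▸ (z : Z).2
        exact this
    · exact Subtype.val_injective
  have : Projective S.X₂ := inferInstanceAs (Projective (ModuleCat.of R F))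
  refine conn_equiv N hS i ?_ (fun x => Ext.eq_zero_of_projective x)
  cases i with
  | zero =>
    intro x
    obtain ⟨φ, rfl⟩ := Ext.mk₀_bijective _ _ |>.2 x
    rw [Ext.mk₀_comp_mk₀, Ext.mk₀_eq_zero_iff]
    ext z
    exact h0 φ.hom z z.2
  | succ i => 
    intro x
    rw [Ext.eq_zero_of_projective x, Ext.comp_zero]

end ExtPart

section ResPart
variable {K : Type} [Field K] {σ : Type} {I : Ideal (MvPolynomial σ K)}

namespace MinFreeRes

lemma range_coeff (F : MinFreeRes I) (i : ℕ) (z : Fin (F.rk i) → MvPolynomial σ K)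
    (hz : z ∈ LinearMap.range (Matrix.mulVecLin (F.d i))) (j : Fin (F.rk i)) :
    constantCoeff (z j) = 0 := by
  obtain ⟨v, rfl⟩ := hz
  simp only [Matrix.mulVecLin_apply, Matrix.mulVec, dotProduct, map_sum, map_mul]
  refine Finset.sum_eq_zero fun k _ => ?_
  rw [constantCoeff_eq, F.minimal, zero_mul]

lemma not_in_range (F : MinFreeRes I) (i : ℕ) (j : Fin (F.rk i)) (v : σ)
    (u : Fin (F.rk i) → MvPolynomial σ K)
    (h : Pi.single j 1 - (X v : MvPolynomial σ K) • u ∈ LinearMap.range (Matrix.mulVecLin (F.d i))) :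
    False := by
  have := F.range_coeff i _ h j
  simp at this

lemma not_in_range' (F : MinFreeRes I) (i : ℕ) (j : Fin (F.rk i)) 
    (h : Pi.single j 1 ∈ LinearMap.range (Matrix.mulVecLin (F.d i))) :
    False := by
  have := F.range_coeff i _ h j
  simp at this

lemma aug_ne (F : MinFreeRes I) (j : Fin (F.rk 0)) : F.aug (Pi.single j 1) ≠ 0 := by
  intro h
  refine F.not_in_range' 0 j ?_
  rw [F.exact_zero]
  exact h

lemma deg_zero_gen {S : Set (σ →₀ ℕ)} (hI : I = Ideal.span ((fun a => monomial a (1 : K)) '' S))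
    (F : MinFreeRes I) (j : Fin (F.rk 0)) : ∃ g ∈ S, g ≤ F.deg 0 j := by
  have h1 : F.aug (Pi.single j 1) ∈ I := (F.range_aug _).1 ⟨_, rfl⟩
  have hI' : ∀ q, q ∈ I ↔ q ∈ Ideal.span ((fun a => monomial a (1 : K)) '' S) := fun q => by rw [← hI]
  rw [hI', mem_ideal_span_monomial_image] at h1
  obtain ⟨m, hm⟩ := MvPolynomial.support_nonempty.2 (F.aug_ne j)
  have h2 := F.aug_homog j hm
  simp only [Finset.mem_singleton, Set.mem_singleton_iff] at h2
  subst h2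
  exact h1 _ hm

lemma X_dvd_of_support (v : σ) (q : MvPolynomial σ K) (h : ∀ m ∈ q.support, m v ≠ 0) :
    X v ∣ q := by
  rw [q.as_sum]
  refine Finset.dvd_sum fun m hm => ?_
  rw [X_dvd_monomial]
  exact Or.inr (h m hm)

lemma deg_lcm {S : Set (σ →₀ ℕ)} (hI : I = Ideal.span ((fun a => monomial a (1 : K)) '' S))
    (F : MinFreeRes I) (i : ℕ) (j : Fin (F.rk i)) (v : σ) (hv : F.deg i j v ≠ 0) :
    ∃ g ∈ S, g ≤ F.deg i j ∧ F.deg i j v ≤ g v := by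
  by_contra! hcon
  induction i with
  | zero =>
    have h1 : F.aug (Pi.single j 1) ∈ I := (F.range_aug _).1 ⟨_, rfl⟩
    obtain ⟨q', hq'⟩ : X v ∣ F.aug (Pi.single j 1) := by
      refine X_dvd_of_support v _ fun m hm => ?_
      have h2 := F.aug_homog j hm
      simp only [Finset.mem_singleton, Set.mem_singleton_iff] at h2
      subst h2
      exact hv
    have h3 : q' ∈ I := by
      have hI' : ∀ q, q ∈ I ↔ q ∈ Ideal.span ((fun a => monomial a (1 : K)) '' S) :=
        fun q => by rw [← hI]
      rw [hI', mem_ideal_span_monomial_image] at h1 ⊢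
      intro m hm
      have hm' : m + Finsupp.single v 1 ∈ (F.aug (Pi.single j 1)).support := by
        rw [hq', mem_support_iff, mul_comm, coeff_mul_X]
        exact mem_support_iff.1 hm
      have h2 := F.aug_homog j hm'
      simp only [Finset.mem_singleton, Set.mem_singleton_iff] at h2
      obtain ⟨g, hg, hgm⟩ := h1 _ hm'
      refine ⟨g, hg, fun x => ?_⟩
      have h4 := hcon g hg (h2 ▸ hgm)
      have h5 := hgm x
      rw [← h2] at h4
      by_cases hx : x = v
      · subst hx
        simp at h4
        omega
      · simpa [Finsupp.single_apply, Ne.symm hx] using h5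
    obtain ⟨u, hu⟩ := (F.range_aug _).2 h3
    refine F.not_in_range 0 j v u ?_
    rw [F.exact_zero, LinearMap.mem_ker, map_sub, map_smul, hu, hq', smul_eq_mul, sub_self]
  | succ i ih =>
    have h1 : ∀ l, X v ∣ F.d i l j := by
      intro l
      refine X_dvd_of_support v _ fun m hm hmv => ?_
      have h2 := F.d_homog i l j m hm
      have h3 : F.deg i l v = F.deg (i+1) j v := by rw [← h2]; simp [hmv]
      refine ih l (h3 ▸ hv) fun g hg hgl => ?_
      rw [h3]
      exact hcon g hg (hgl.trans (h2 ▸ le_self_add))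
    choose u hu using h1
    have hcol : (Matrix.mulVecLin (F.d i)) (Pi.single j 1) = (X v : MvPolynomial σ K) • u := by
      ext1 l
      simp [hu]
    have hX : (X v : MvPolynomial σ K) ≠ 0 := X_ne_zero v
    have hur : u ∈ LinearMap.range (Matrix.mulVecLin (F.d i)) := by
      have hmem : (X v : MvPolynomial σ K) • u ∈ LinearMap.range (Matrix.mulVecLin (F.d i)) :=
        ⟨_, hcol⟩
      cases i with
      | zero =>
        rw [F.exact_zero, LinearMap.mem_ker, map_smul, smul_eq_zero] at hmem
        rw [F.exact_zero, LinearMap.mem_ker]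
        exact hmem.resolve_left hX
      | succ i =>
        rw [F.exact_succ, LinearMap.mem_ker, map_smul, smul_eq_zero] at hmem
        rw [F.exact_succ, LinearMap.mem_ker]
        exact hmem.resolve_left hX
    obtain ⟨u', hu'⟩ := hur
    refine F.not_in_range (i+1) j v u' ?_
    rw [F.exact_succ, LinearMap.mem_ker, map_sub, map_smul, hu', hcol, sub_self]

lemma deg_succ (F : MinFreeRes I) (i : ℕ) (k : Fin (F.rk (i+1))) :
    ∃ j m, m ≠ 0 ∧ F.deg i j + m = F.deg (i+1) k := by
  have h : ∃ j, F.d i j k ≠ 0 := by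
    by_contra! h
    refine F.not_in_range' (i+1) k ?_
    rw [F.exact_succ, LinearMap.mem_ker]
    ext1 l
    simp [h]
  obtain ⟨j, hj⟩ := h
  obtain ⟨m, hm⟩ := MvPolynomial.support_nonempty.2 hj
  refine ⟨j, m, ?_, F.d_homog i j k m hm⟩
  rintro rfl
  exact mem_support_iff.1 hm (F.minimal i j k)

open CategoryTheory CategoryTheory.Abelian

lemma hom_zero (F : MinFreeRes I) (N : Type) [AddCommGroup N] [Module (MvPolynomial σ K) N]
    (hN : ∀ r : MvPolynomial σ K, constantCoeff r = 0 → ∀ x : N, r • x = 0) (i : ℕ)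
    (φ : (Fin (F.rk i) → MvPolynomial σ K) →ₗ[MvPolynomial σ K] N)
    (z) (hz : z ∈ LinearMap.range (Matrix.mulVecLin (F.d i))) : φ z = 0 := by
  rw [LinearMap.pi_apply_eq_sum_univ φ z]
  exact Finset.sum_eq_zero fun j _ => hN _ (F.range_coeff i z hz j) _

lemma syz_equiv (F : MinFreeRes I) (N : ModuleCat.{0} (MvPolynomial σ K))
    (hN : ∀ r : MvPolynomial σ K, constantCoeff r = 0 → ∀ x : N, r • x = 0) (i k : ℕ) :
    Nonempty (Ext (ModuleCat.of (MvPolynomial σ K)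
      (LinearMap.range (Matrix.mulVecLin (F.d i)))) N k ≃ₗ[MvPolynomial σ K]
      Ext (ModuleCat.of (MvPolynomial σ K) I) N (k + i + 1)) := by
  induction i generalizing k with
  | zero =>
    refine shift_equiv N (F.aug.codRestrict I (fun x => (F.range_aug _).1 ⟨x, rfl⟩)) ?_ _ ?_
      (F.hom_zero N hN 0) k
    · rintro ⟨y, hy⟩
      obtain ⟨x, hx⟩ := (F.range_aug _).2 hy
      exact ⟨x, Subtype.ext hx⟩
    · rw [F.exact_zero, LinearMap.ker_codRestrict]
  | succ i ih =>
    obtain ⟨e⟩ := ih (k+1)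
    obtain ⟨e'⟩ := shift_equiv N (Matrix.mulVecLin (F.d i)).rangeRestrict
      (LinearMap.surjective_rangeRestrict _) (LinearMap.range (Matrix.mulVecLin (F.d (i+1))))
      (by rw [F.exact_succ, LinearMap.ker_rangeRestrict]) (F.hom_zero N hN (i+1)) k
    rw [show k + (i + 1) + 1 = k + 1 + i + 1 by omega]
    exact ⟨e'.trans e⟩

lemma hom_equiv {R : Type} [CommRing R] (N : ModuleCat.{0} R) (M : Type) [AddCommGroup M]
    [Module R M] (n : ℕ) (e : (Fin n → R) ≃ₗ[R] M) :
    Nonempty (Ext (ModuleCat.of R M) N 0 ≃ₗ[R] (Fin n → N)) := by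
  refine ⟨Ext.linearEquiv₀.trans ((ModuleCat.homLinearEquiv (S := R)).trans
    ((LinearEquiv.congrLeft N R e.symm).trans
      (LinearMap.lsum R (fun _ : Fin n => R) R).symm |>.trans
      (LinearEquiv.piCongrRight fun _ => LinearMap.ringLmapEquivSelf R R N)))⟩

lemma top_equiv (F : MinFreeRes I) (N : ModuleCat.{0} (MvPolynomial σ K))
    (hN : ∀ r : MvPolynomial σ K, constantCoeff r = 0 → ∀ x : N, r • x = 0) (p : ℕ)
    (hp : F.rk (p+1) = 0) :
    Nonempty (Ext (ModuleCat.of (MvPolynomial σ K) I) N p ≃ₗ[MvPolynomial σ K]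
      (Fin (F.rk p) → N)) := by
  have hbot : LinearMap.range (Matrix.mulVecLin (F.d p)) = ⊥ := by
    rw [LinearMap.range_eq_bot]
    ext1 
    have : IsEmpty (Fin (F.rk (p+1))) := by rw [hp]; infer_instance
    exact isEmptyElim ‹Fin (F.rk (p+1))›
  cases p with
  | zero =>
    refine hom_equiv N _ _ (LinearEquiv.ofBijective
      (F.aug.codRestrict I (fun x => (F.range_aug _).1 ⟨x, rfl⟩)) ⟨?_, ?_⟩)
    · rw [← LinearMap.ker_eq_bot, LinearMap.ker_codRestrict, ← F.exact_zero, hbot]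
    · rintro ⟨y, hy⟩
      obtain ⟨x, hx⟩ := (F.range_aug _).2 hy
      exact ⟨x, Subtype.ext hx⟩
  | succ q =>
    obtain ⟨e⟩ := F.syz_equiv N hN q 0
    obtain ⟨e'⟩ := hom_equiv N _ _ (LinearEquiv.ofBijective
      (Matrix.mulVecLin (F.d q)).rangeRestrict ⟨by
        rw [← LinearMap.ker_eq_bot, LinearMap.ker_rangeRestrict, ← F.exact_succ, hbot],
      LinearMap.surjective_rangeRestrict _⟩)
    rw [zero_add] at e
    exact ⟨e.symm.trans e'⟩

end MinFreeRes
end ResPart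

/-- The residue field `K` as a module over the polynomial ring. -/
def ResK (K _σ : Type) : Type := K

noncomputable instance (K σ : Type) [Field K] : AddCommGroup (ResK K σ) :=
  inferInstanceAs (AddCommGroup K)

noncomputable instance (K σ : Type) [Field K] : Module (MvPolynomial σ K) (ResK K σ) :=
  Module.compHom K (constantCoeff : MvPolynomial σ K →+* K)

noncomputable instance (K σ : Type) [Field K] : Module K (ResK K σ) :=
  inferInstanceAs (Module K K)

lemma resK_smul (K σ : Type) [Field K] (r : MvPolynomial σ K) (x : ResK K σ) :
    r • x = constantCoeff r • x := rfl

lemma resK_rank (K σ : Type) [Field K] (n : ℕ)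
    (e : (Fin n → ResK K σ) ≃ₗ[MvPolynomial σ K] ResK K σ) : n = 1 := by
  let f : (Fin n → ResK K σ) ≃ₗ[K] ResK K σ :=
    { toFun := e
      invFun := e.symm
      left_inv := e.left_inv
      right_inv := e.right_inv
      map_add' := e.map_add
      map_smul' := fun c x => by
        have h := e.map_smul (C c) x
        have h1 : (C c : MvPolynomial σ K) • x = c • x := by
          funext i
          rw [Pi.smul_apply, resK_smul, constantCoeff_C]
          rfl
        rw [h1, resK_smul, constantCoeff_C] at h
        exact h }
  have h1 : Module.finrank K (ResK K σ) = 1 := Module.finrank_self K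
  have : Module.Finite K (ResK K σ) := inferInstanceAs (Module.Finite K K)
  have := f.finrank_eq
  rw [Module.finrank_pi_fintype] at this
  simpa [h1] using this

section MonPart
variable {K : Type} [Field K] {σ : Type}

lemma mon_reg (S : Set (σ →₀ ℕ)) (m0 : σ →₀ ℕ)
    (h : ∀ m, ∀ g ∈ S, g ≤ m + m0 → ∃ g' ∈ S, g' ≤ m) (a : MvPolynomial σ K)
    (ha : monomial m0 1 * a ∈ Ideal.span ((fun a => monomial a (1 : K)) '' S)) :
    a ∈ Ideal.span ((fun a => monomial a (1 : K)) '' S) := by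
  rw [mem_ideal_span_monomial_image] at ha ⊢
  intro m hm
  obtain ⟨g, hg, hgm⟩ := ha (m + m0) (by
    rw [mem_support_iff, add_comm, coeff_monomial_mul, one_mul]
    exact mem_support_iff.1 hm)
  exact h m g hg hgm

end MonPart


section Main
variable {K : Type} [Field K] {s t : ℕ}

/-- Exponents of the generators. -/
noncomputable def genExp (w : Fin t → ℕ) (i : Fin s) (j : Fin t) : (Fin s ⊕ Fin t) →₀ ℕ :=
  Finsupp.single (Sum.inl i) 1 + Finsupp.single (Sum.inr j) (w j)

lemma topExt_J (hs : 1 ≤ s) (ht : 1 ≤ t) (w : Fin t → ℕ) (hw : ∀ j, 1 ≤ w j) :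
    TopExt (ModuleCat.of (MvPolynomial (Fin s ⊕ Fin t) K) (ResK K (Fin s ⊕ Fin t)))
      (ModuleCat.of (MvPolynomial (Fin s ⊕ Fin t) K)
        (Ideal.span ((fun a => monomial a (1 : K)) '' {a | ∃ i j, a = genExp w i j}) :
          Ideal (MvPolynomial (Fin s ⊕ Fin t) K))) (s + t - 2) := by
  obtain ⟨s, rfl⟩ : ∃ s', s = s' + 1 := ⟨s - 1, by omega⟩
  obtain ⟨t, rfl⟩ : ∃ t', t = t' + 1 := ⟨t - 1, by omega⟩
  set N := ModuleCat.of (MvPolynomial (Fin (s+1) ⊕ Fin (t+1)) K)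
    (ResK K (Fin (s+1) ⊕ Fin (t+1))) with hN
  have hkill : ∀ m : (Fin (s+1) ⊕ Fin (t+1)) →₀ ℕ, m ≠ 0 → ∀ x : N, monomial m (1 : K) • x = 0 := by
    intro m hm x
    change (ResK K (Fin (s+1) ⊕ Fin (t+1))) at x
    change monomial m (1 : K) • x = 0
    rw [resK_smul, constantCoeff_eq, coeff_monomial, if_neg hm, zero_smul]
  let ey : ℕ → (Fin (s+1) ⊕ Fin (t+1)) →₀ ℕ := fun k =>
    Finsupp.single (Sum.inr (Fin.ofNat (t+1) k)) (w (Fin.ofNat (t+1) k))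
  let ex : ℕ → (Fin (s+1) ⊕ Fin (t+1)) →₀ ℕ := fun k =>
    Finsupp.single (Sum.inl (Fin.ofNat (s+1) k)) 1
  have hey : ∀ k, ey k ≠ 0 := fun k h => by
    have := hw (Fin.ofNat (t+1) k)
    rw [Finsupp.single_eq_zero] at h
    omega
  have hex : ∀ k, ex k ≠ 0 := fun k h => by
    rw [Finsupp.single_eq_zero] at h
    omega
  -- the `y` part
  have hY : ∀ k, Ideal.span ((fun k => monomial (ey k) (1 : K)) '' {l | l < k}) * ⊤ =
      Ideal.span ((fun a => monomial a (1 : K)) '' (ey '' {l | l < k})) := by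
    intro k
    rw [Ideal.mul_top, Set.image_image]
  have hX : ∀ k, Ideal.span ((fun k => monomial (ex k) (1 : K)) '' {l | l < k}) *
      Ideal.span ((fun a => monomial a (1 : K)) '' (ey '' {l | l < t + 1})) =
      Ideal.span ((fun a => monomial a (1 : K)) ''
        {a | ∃ l < k, ∃ j < t + 1, a = ex l + ey j}) := by
    intro k
    rw [Ideal.span_mul_span']
    congr 1
    ext p
    simp only [Set.mem_mul, Set.mem_image, Set.mem_ofPred_eq]
    constructor
    · rintro ⟨_, ⟨l, hl, rfl⟩, _, ⟨_, ⟨j, hj, rfl⟩, rfl⟩, rfl⟩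
      exact ⟨_, ⟨l, hl, j, hj, rfl⟩, by rw [monomial_mul, one_mul]⟩
    · rintro ⟨_, ⟨l, hl, j, hj, rfl⟩, rfl⟩
      exact ⟨_, ⟨l, hl, rfl⟩, _, ⟨_, ⟨j, hj, rfl⟩, rfl⟩, by rw [monomial_mul, one_mul]⟩
  have h1 := (topExt_chain N ⊤ 0 (topExt_top N) t (fun k => monomial (ey k) (1 : K))
    (fun k _ => by simp) (fun k _ => hkill _ (hey k)) (by
      intro k hk a _ ha
      rw [hY] at ha ⊢
      refine mon_reg _ (ey k) ?_ a ha
      rintro m _ ⟨l, hl, rfl⟩ hle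
      refine ⟨_, ⟨l, hl, rfl⟩, ?_⟩
      have hl' : l < k := hl
      rw [Finsupp.single_le_iff] at hle ⊢
      have hne : Fin.ofNat (t+1) k ≠ Fin.ofNat (t+1) l := by
        intro h
        have := congrArg Fin.val h
        simp only [Fin.ofNat, Nat.mod_eq_of_lt hk, Nat.mod_eq_of_lt (hl'.trans hk)] at this
        omega
      rw [Finsupp.add_apply, Finsupp.single_apply, if_neg (by simpa using hne)] at hle
      simpa using hle)).1
  rw [hY] at h1
  have h2 := (topExt_chain N _ _ h1 s (fun k => monomial (ex k) (1 : K))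
    (fun k _ => by simp) (fun k _ => hkill _ (hex k)) (by
      intro k hk a _ ha
      rw [hX] at ha ⊢
      refine mon_reg _ (ex k) ?_ a ha
      rintro m _ ⟨l, hl, j, hj, rfl⟩ hle
      refine ⟨_, ⟨l, hl, j, hj, rfl⟩, fun x => ?_⟩
      have hlx := hle x
      have hne : Fin.ofNat (s+1) k ≠ Fin.ofNat (s+1) l := by
        intro h
        have := congrArg Fin.val h
        simp only [Fin.ofNat, Nat.mod_eq_of_lt hk, Nat.mod_eq_of_lt (hl.trans hk)] at this
        omega
      by_cases hx : x = Sum.inl (Fin.ofNat (s+1) k)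
      · subst hx
        have hz : (ex l + ey j) (Sum.inl (Fin.ofNat (s+1) k)) = 0 := by
          simp only [ex, ey, Finsupp.add_apply, Finsupp.single_apply, Sum.inl.injEq,
            if_neg hne.symm, reduceCtorEq, if_false, add_zero]
        rw [hz]
        exact Nat.zero_le _
      · have : ex k x = 0 := by
          simp only [ex, Finsupp.single_apply, if_neg (Ne.symm hx)]
        simpa [this] using hlx)).1
  rw [hX] at h2
  have e1 : 0 + t + s = s + 1 + (t + 1) - 2 := by omega
  have e2 : {a | ∃ l < s + 1, ∃ j < t + 1, a = ex l + ey j} = {a | ∃ i j, a = genExp w i j} := by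
    ext a
    constructor
    · rintro ⟨l, _, j, _, rfl⟩
      exact ⟨_, _, rfl⟩
    · rintro ⟨i, j, rfl⟩
      exact ⟨i, i.2, j, j.2, by simp [ex, ey, genExp]⟩
  rw [e1, e2] at h2
  exact h2

lemma J_eq (w : Fin t → ℕ) : Ideal.span {p : MvPolynomial (Fin s ⊕ Fin t) K |
      ∃ (i : Fin s) (j : Fin t), p = X (Sum.inl i) * X (Sum.inr j) ^ w j} =
    Ideal.span ((fun a => monomial a (1 : K)) '' {a | ∃ i j, a = genExp w i j}) := by
  congr 1
  ext p
  have h : ∀ (i : Fin s) (j : Fin t), (X (Sum.inl i) * X (Sum.inr j) ^ w j :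
      MvPolynomial (Fin s ⊕ Fin t) K) = monomial (genExp w i j) 1 := by
    intro i j
    rw [X_pow_eq_monomial, X, monomial_mul, one_mul, genExp]
  constructor
  · rintro ⟨i, j, rfl⟩
    exact ⟨_, ⟨i, j, rfl⟩, (h i j).symm⟩
  · rintro ⟨_, ⟨i, j, rfl⟩, rfl⟩
    exact ⟨i, j, (h i j).symm⟩

end Main

/-- The edge ideal `J_{s,t} = (x_i y_j^{w_j})` of the weighted oriented complete
bipartite graph `K_{s,t}` has `pdim = s + t - 2`, and its top multigraded Betti
number is `1` at `α = x_1⋯x_s·y_1^{w_1}⋯y_t^{w_t}` and `0` otherwise. -/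
theorem stmt14 {K : Type} [Field K] (s t : ℕ) (hs : 1 ≤ s) (ht : 1 ≤ t)
    (w : Fin t → ℕ) (hw : ∀ j, 1 ≤ w j)
    (J : Ideal (MvPolynomial (Fin s ⊕ Fin t) K))
    (hJ : J = Ideal.span {p | ∃ (i : Fin s) (j : Fin t),
      p = X (Sum.inl i) * X (Sum.inr j) ^ w j})
    (Θ : (Fin s ⊕ Fin t) →₀ ℕ)
    (hΘ : Θ = Finsupp.equivFunOnFinite.symm (Sum.elim (fun _ => 1) w))
    (F : MinFreeRes J) :
    F.IsPdim (s + t - 2) ∧ ∀ a, F.cnt (s + t - 2) a = if a = Θ then 1 else 0 := by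
  have hJS := hJ.trans (J_eq w)
  have hΘl : ∀ i, Θ (Sum.inl i) = 1 := fun i => by rw [hΘ]; rfl
  have hΘr : ∀ j, Θ (Sum.inr j) = w j := fun j => by rw [hΘ]; rfl
  have hgen : ∀ i j v, genExp w i j v ≠ 0 → genExp w i j v = Θ v := by
    intro i j v hv
    rcases v with a | b
    · by_cases h : i = a
      · subst h
        simp [genExp, hΘl]
      · simp [genExp, Finsupp.single_apply, h] at hv
    · by_cases h : j = b
      · subst h
        simp [genExp, hΘr]
      · simp [genExp, Finsupp.single_apply, h] at hv
  have hval : ∀ i j v, F.deg i j v ≠ 0 → F.deg i j v = Θ v := by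
    intro i j v hv
    obtain ⟨_, ⟨a, b, rfl⟩, hle, hge⟩ := F.deg_lcm hJS i j v hv
    have h1 := le_antisymm hge (hle v)
    rw [h1] at hv ⊢
    exact hgen a b v hv
  have hcard : ∀ i j, i + 2 ≤ (F.deg i j).support.card := by
    intro i
    induction i with
    | zero =>
      intro j
      obtain ⟨_, ⟨a, b, rfl⟩, hle⟩ := F.deg_zero_gen hJS j
      have h1 : ({Sum.inl a, Sum.inr b} : Finset (Fin s ⊕ Fin t)) ⊆ (F.deg 0 j).support := by
        intro v hv
        have h2 := hle v
        rw [Finsupp.mem_support_iff]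
        have h3 : genExp w a b v ≠ 0 := by
          simp only [Finset.mem_insert, Finset.mem_singleton] at hv
          rcases hv with rfl | rfl
          · simp [genExp]
          · have := hw b
            simp [genExp]
            omega
        omega
      have h2 := Finset.card_le_card h1
      rw [Finset.card_pair (by simp)] at h2
      omega
    | succ i ih =>
      intro k
      obtain ⟨j, m, hm, hjm⟩ := F.deg_succ i k
      have hle : F.deg i j ≤ F.deg (i+1) k := hjm ▸ le_self_add
      have hss : (F.deg i j).support ⊂ (F.deg (i+1) k).support := by
        refine (Finsupp.support_mono hle).ssubset_of_ne fun heq => hm ?_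
        have : F.deg i j = F.deg (i+1) k := by
          ext v
          by_cases hv : v ∈ (F.deg i j).support
          · have hv' := heq ▸ hv
            rw [Finsupp.mem_support_iff] at hv hv'
            rw [hval _ _ _ hv, hval _ _ _ hv']
          · have hv' := heq ▸ hv
            rw [Finsupp.notMem_support_iff] at hv hv'
            rw [hv, hv']
        rw [← this] at hjm
        simpa using hjm
      have := Finset.card_lt_card hss
      have := ih j
      omega
  have hcard' : ∀ i j, (F.deg i j).support.card ≤ s + t := fun i j => by
    have := Finset.card_le_univ (F.deg i j).support
    simpa using this
  have hzero : ∀ i, s + t - 2 < i → F.rk i = 0 := by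
    intro i hi
    by_contra hne
    have := hcard i ⟨0, Nat.pos_of_ne_zero hne⟩
    have := hcard' i ⟨0, Nat.pos_of_ne_zero hne⟩
    omega
  have hdeg : ∀ j, F.deg (s + t - 2) j = Θ := by
    intro j
    have h1 := hcard _ j
    have h2 : (F.deg (s + t - 2) j).support = Finset.univ := by
      apply Finset.eq_univ_of_card
      have := hcard' _ j
      simp only [Fintype.card_sum, Fintype.card_fin]
      omega
    ext v
    exact hval _ _ _ (Finsupp.mem_support_iff.1 (h2 ▸ Finset.mem_univ v))
  have hrk : F.rk (s + t - 2) = 1 := by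
    obtain ⟨e⟩ := F.top_equiv (ModuleCat.of _ (ResK K (Fin s ⊕ Fin t))) (by
      intro r hr x
      change ResK K (Fin s ⊕ Fin t) at x
      change r • x = 0
      rw [resK_smul, hr, zero_smul]) (s + t - 2) (hzero _ (Nat.lt_succ_self _))
    have htop := topExt_J (K := K) hs ht w hw
    rw [← hJS] at htop
    obtain ⟨⟨e'⟩, _⟩ := htop
    exact resK_rank K (Fin s ⊕ Fin t) _ (e.symm.trans e')
  refine ⟨⟨by omega, hzero⟩, fun a => ?_⟩
  unfold MinFreeRes.cnt
  split_ifs with ha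
  · subst ha
    rw [Nat.card_congr (Equiv.subtypeUnivEquiv hdeg), Nat.card_fin, hrk]
  · have : IsEmpty {j : Fin (F.rk (s + t - 2)) // F.deg (s + t - 2) j = a} :=
      ⟨fun j => ha (j.2.symm.trans (hdeg j.1))⟩
    exact Nat.card_of_isEmpty
end

section
/- Let I_s = (x_i y_j^{w_j} : 1 ≤ i,j ≤ s, i ≠ j) be the edge ideal of the weighted oriented crown graph G_s in R = K[x_1,...,x_s, y_1,...,y_s], where w_1,...,w_s are positive integers and s ≥ 2. Then pdim(I_s) = 2s − 3, and the top multigraded Betti number β_{2s-3,α}(I_s) equals s−1 if x^α = x_1···x_s·y_1^{w_1}···y_s^{w_s}, and 0 otherwise. -/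
open MvPolynomial

open Classical in
/-- scalar strand data -/
structure Str (K : Type) [Field K] (σ : Type) (P : (σ →₀ ℕ) → Prop) where
  ι : ℕ → Type
  ft : ∀ n, Fintype (ι n)
  deg : ∀ n, ι n → σ →₀ ℕ
  m : ∀ n, Matrix (ι n) (ι (n+1)) K
  Pdeg : ∀ n j, P (deg (n+2) j)
  mle : ∀ n j k, m n j k ≠ 0 → deg n j ≤ deg (n+1) k
  mne : ∀ n j k, m (n+2) j k ≠ 0 → deg (n+2) j ≠ deg (n+3) k
  comp : ∀ n (y : ι (n+2) → K), (m n).mulVec ((m (n+1)).mulVec y) = 0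
  ex : ∀ b, P b → ∀ n (z : ι (n+1) → K), (∀ j, z j ≠ 0 → deg (n+1) j ≤ b) →
    (m n).mulVec z = 0 →
    ∃ y : ι (n+2) → K, (∀ j, y j ≠ 0 → deg (n+2) j ≤ b) ∧ (m (n+1)).mulVec y = z

attribute [instance] Str.ft

namespace Str

variable {K : Type} [Field K] {σ : Type} {P : (σ →₀ ℕ) → Prop}

/-- live elements of the relative complex -/
def lv (S : Str K σ P) (U : Finset σ) (b : σ →₀ ℕ) (n : ℕ) (j : S.ι n) : Prop :=
  P b ∧ (n ≤ 1 ∨ ∃ v ∈ U, S.deg n j ≤ b - Finsupp.single v 1)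

/-- exactness of the relative complex -/
def Ex (S : Str K σ P) (n : ℕ) (U : Finset σ) (b : σ →₀ ℕ) : Prop :=
  ∀ z : S.ι (n+1) → K, (∀ j, z j ≠ 0 → S.lv U b (n+1) j) → (S.m n).mulVec z = 0 →
    ∃ y : S.ι (n+2) → K, (∀ j, y j ≠ 0 → S.lv U b (n+2) j) ∧ (S.m (n+1)).mulVec y = z

variable (S : Str K σ P)

lemma exists_of_mulVec_ne {n : ℕ} {z : S.ι (n+1) → K} {j : S.ι n}
    (h : (S.m n).mulVec z j ≠ 0) : ∃ k, S.m n j k ≠ 0 ∧ z k ≠ 0 := by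
  by_contra hc
  push Not at hc
  apply h
  rw [Matrix.mulVec, dotProduct]
  apply Finset.sum_eq_zero
  intro k _
  by_cases hk : S.m n j k = 0
  · simp [hk]
  · simp [hc k hk]

lemma lv_bdry {U : Finset σ} {b : σ →₀ ℕ} {n : ℕ} {z : S.ι (n+1) → K}
    (hz : ∀ j, z j ≠ 0 → S.lv U b (n+1) j) (j : S.ι n) (h : (S.m n).mulVec z j ≠ 0) :
    S.lv U b n j := by
  obtain ⟨k, hk, hzk⟩ := S.exists_of_mulVec_ne h
  obtain ⟨hP, h2⟩ := hz k hzk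
  refine ⟨hP, ?_⟩
  rcases h2 with h2 | ⟨v, hv, h2⟩
  · left; omega
  · right
    exact ⟨v, hv, (S.mle _ _ _ hk).trans h2⟩

lemma deg_bdry {b : σ →₀ ℕ} {n : ℕ} {z : S.ι (n+1) → K}
    (hz : ∀ j, z j ≠ 0 → S.deg (n+1) j ≤ b) (j : S.ι n) (h : (S.m n).mulVec z j ≠ 0) :
    S.deg n j ≤ b := by
  obtain ⟨k, hk, hzk⟩ := S.exists_of_mulVec_ne h
  exact (S.mle _ _ _ hk).trans (hz k hzk)

lemma Ex_of_not (n : ℕ) (U : Finset σ) (b : σ →₀ ℕ) (h : ¬ P b) : S.Ex n U b := by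
  intro z hz _
  have : z = 0 := by
    funext j
    by_contra hj
    exact h (hz j hj).1
  exact ⟨0, by simp, by simp [this]⟩

lemma Ex_empty (n : ℕ) (b : σ →₀ ℕ) : S.Ex (n+1) ∅ b := by
  intro z hz _
  have : z = 0 := by
    funext j
    by_contra hj
    rcases (hz j hj).2 with h | ⟨v, hv, _⟩
    · omega
    · simp at hv
  exact ⟨0, by simp, by simp [this]⟩

variable [DecidableEq σ]

lemma MV (hP : ∀ a b, a ≤ b → P a → P b) (hd1 : ∀ j, S.deg 1 j = 0) (n : ℕ) (U : Finset σ)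
    (b : σ →₀ ℕ) (v : σ) (hv : v ∉ U)
    (h1 : S.Ex n U b) (h2 : ∀ m, n = m + 1 → S.Ex m U (b - Finsupp.single v 1)) :
    S.Ex n (insert v U) b := by
  classical
  intro z hz hc
  have hlvmono : ∀ (n : ℕ) (j : S.ι n), S.lv U b n j → S.lv (insert v U) b n j := by
    rintro n j ⟨hp, h | ⟨u, hu, h⟩⟩
    · exact ⟨hp, Or.inl h⟩
    · exact ⟨hp, Or.inr ⟨u, Finset.mem_insert_of_mem hu, h⟩⟩
  rcases n with _ | n
  · obtain ⟨y, hy, hyz⟩ := h1 z (fun j hj => ⟨(hz j hj).1, Or.inl (by omega)⟩) hc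
    exact ⟨y, fun j hj => hlvmono _ _ (hy j hj), hyz⟩
  have h2 := h2 n rfl
  set c := b - Finsupp.single v 1 with hcdef
  have hcb : c ≤ b := tsub_le_self
  let z1 : S.ι (n+2) → K := fun j => if S.lv U b (n+2) j then z j else 0
  let z2 : S.ι (n+2) → K := fun j => if S.lv U b (n+2) j then 0 else z j
  have hz12 : z = z1 + z2 := by
    funext j; simp only [z1, z2, Pi.add_apply]; split_ifs <;> simp
  have hz1 : ∀ j, z1 j ≠ 0 → S.lv U b (n+2) j := by
    intro j hj
    by_contra hn
    simp [z1, hn] at hj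
  have hz2 : ∀ j, z2 j ≠ 0 → S.deg (n+2) j ≤ c := by
    intro j hj
    by_cases hn : S.lv U b (n+2) j
    · simp [z2, hn] at hj
    · simp only [z2, hn, if_false] at hj
      obtain ⟨hp, h | ⟨u, hu, h⟩⟩ := hz j hj
      · omega
      · rcases Finset.mem_insert.1 hu with rfl | hu
        · exact h
        · exact absurd ⟨hp, Or.inr ⟨u, hu, h⟩⟩ hn
  by_cases hPc : P c
  swap
  · have : z2 = 0 := by
      funext j
      by_contra hj
      exact hPc (hP _ _ (hz2 j hj) (S.Pdeg _ _))
    rw [this, add_zero] at hz12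
    obtain ⟨y, hy, hyz⟩ := h1 z (by rw [hz12]; exact hz1) hc
    exact ⟨y, fun j hj => hlvmono _ _ (hy j hj), hyz⟩
  have hneg : (S.m (n+1)).mulVec z1 = - (S.m (n+1)).mulVec z2 := by
    rw [hz12, Matrix.mulVec_add] at hc
    exact eq_neg_of_add_eq_zero_left hc
  have hw : ∀ j, (S.m (n+1)).mulVec z1 j ≠ 0 → S.lv U c (n+1) j := by
    intro j hj
    have ha := S.lv_bdry hz1 j hj
    rw [hneg] at hj
    have hb := S.deg_bdry hz2 j (by simpa using hj)
    refine ⟨hPc, ?_⟩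
    rcases ha.2 with h | ⟨u, hu, h⟩
    · exact Or.inl h
    · refine Or.inr ⟨u, hu, ?_⟩
      have huv : u ≠ v := fun h => hv (h ▸ hu)
      intro t
      have e1 := h t
      have e2 := hb t
      simp only [hcdef, Finsupp.coe_tsub, Pi.sub_apply, Finsupp.single_apply] at e1 e2 ⊢
      split_ifs at e1 e2 ⊢ with q1 q2 q2
      · exact absurd (q2.trans q1.symm) huv
      all_goals omega
  obtain ⟨u, hu, huz⟩ := h2 _ hw (S.comp _ _)
  have huc : ∀ j, u j ≠ 0 → S.deg (n+2) j ≤ c := by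
    intro j hj
    rcases (hu j hj).2 with h | ⟨t, ht, h⟩
    · omega
    · exact h.trans tsub_le_self
  have hub : ∀ j, u j ≠ 0 → S.lv U b (n+2) j := by
    intro j hj
    obtain ⟨hp, h | ⟨t, ht, h⟩⟩ := hu j hj
    · omega
    · exact ⟨hP _ _ hcb hp, Or.inr ⟨t, ht, h.trans (tsub_le_tsub_right hcb _)⟩⟩
  obtain ⟨y1, hy1, e1⟩ := h1 (z1 - u) (by
    intro j hj
    by_cases h : z1 j = 0
    · exact hub j (by intro h'; simp [h, h'] at hj)
    · exact hz1 j h) (by rw [Matrix.mulVec_sub, huz, sub_self])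
  obtain ⟨y2, hy2, e2⟩ := S.ex c hPc (n+1) (z2 + u) (by
    intro j hj
    by_cases h : z2 j = 0
    · exact huc j (by intro h'; simp [h, h'] at hj)
    · exact hz2 j h) (by rw [Matrix.mulVec_add, huz, hneg, add_neg_cancel])
  refine ⟨y1 + y2, ?_, ?_⟩
  · intro j hj
    by_cases h : y1 j = 0
    · have := hy2 j (by intro h'; simp [h, h'] at hj)
      exact ⟨hP _ _ hcb hPc, Or.inr ⟨v, Finset.mem_insert_self _ _, this⟩⟩
    · exact hlvmono _ _ (hy1 j h)
  · rw [Matrix.mulVec_add, e1, e2, hz12]; abel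

lemma cone_one (hP : ∀ a b, a ≤ b → P a → P b) (hd1 : ∀ j, S.deg 1 j = 0) (n : ℕ)
    (b : σ →₀ ℕ) (v : σ) (h : P b → P (b - Finsupp.single v 1)) : S.Ex n {v} b := by
  by_cases hb : P b
  swap
  · exact S.Ex_of_not _ _ _ hb
  intro z hz hc
  obtain ⟨y, hy, e⟩ := S.ex _ (h hb) n z (by
    intro j hj
    rcases n with _ | n
    · rw [hd1]; exact zero_le
    · rcases (hz j hj).2 with h | ⟨t, ht, h⟩
      · omega
      · simp at ht; rw [ht] at h; exact h) hc
  exact ⟨y, fun j hj => ⟨hb, Or.inr ⟨v, by simp, hy j hj⟩⟩, e⟩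

lemma cone (hP : ∀ a b, a ≤ b → P a → P b) (hd1 : ∀ j, S.deg 1 j = 0) (v : σ) (U : Finset σ) :
    v ∉ U → ∀ (n : ℕ) (b : σ →₀ ℕ),
    (∀ c ≤ b, (∀ u, u ∉ U → c u = b u) → P c → P (c - Finsupp.single v 1)) →
    S.Ex n (insert v U) b := by
  induction U using Finset.induction_on with
  | empty =>
    intro _ n b h
    exact S.cone_one hP hd1 n b v (h b le_rfl (fun _ _ => rfl))
  | insert u U hu ih =>
    intro hv n b h
    simp only [Finset.mem_insert, not_or] at hv
    rw [Finset.insert_comm]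
    apply S.MV hP hd1
    · simp [hu, Ne.symm hv.1]
    · exact ih hv.2 n b fun c hc hcu => h c hc fun t ht => hcu t (by
        simp only [Finset.mem_insert, not_or] at ht; exact ht.2)
    · intro m _
      apply ih hv.2
      intro c hc hcu
      apply h c (hc.trans tsub_le_self)
      intro t ht
      simp only [Finset.mem_insert, not_or] at ht
      rw [hcu t ht.2]
      simp [Finsupp.single_apply, Ne.symm ht.1]

/-- vanishing of Betti numbers from exactness -/
lemma no_gen (n : ℕ) (a : σ →₀ ℕ) (h : S.Ex n a.support a) (j : S.ι (n+2)) :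
    S.deg (n+2) j ≠ a := by
  classical
  intro hj
  have hPa : P a := hj ▸ S.Pdeg n j
  let e : S.ι (n+2) → K := Pi.single j 1
  obtain ⟨u, hu, hue⟩ := h ((S.m (n+1)).mulVec e) (by
    intro k hk
    refine ⟨hPa, ?_⟩
    rcases n with _ | n
    · left; omega
    right
    obtain ⟨l, hl, hl'⟩ := S.exists_of_mulVec_ne hk
    have : l = j := by
      by_contra hne
      simp [e, hne] at hl'
    subst this
    have hle := S.mle _ _ _ hl
    have hne := S.mne _ _ _ hl
    rw [hj] at hle hne
    obtain ⟨v, hv⟩ : ∃ v, S.deg (n+2) k v ≠ a v := by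
      by_contra hcon
      push Not at hcon
      exact hne (Finsupp.ext hcon)
    have hlt := lt_of_le_of_ne (hle v) hv
    refine ⟨v, by simp; omega, ?_⟩
    intro t
    have := hle t
    simp only [Finsupp.coe_tsub, Pi.sub_apply, Finsupp.single_apply]
    split_ifs with q
    · subst q; omega
    · simpa using this) (S.comp _ _)
  have huj : u j = 0 := by
    by_contra hne
    rcases (hu j hne).2 with h | ⟨v, hv, h⟩
    · omega
    · rw [hj] at h
      have := h v
      simp at this hv
      omega
  obtain ⟨z, hz, hze⟩ := S.ex a hPa (n+1) (e - u) (by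
    intro k hk
    by_cases hkj : k = j
    · rw [hkj, hj]
    · have : u k ≠ 0 := by intro h'; simp [e, hkj, h'] at hk
      rcases (hu k this).2 with h | ⟨v, hv, h⟩
      · omega
      · exact h.trans tsub_le_self) (by rw [Matrix.mulVec_sub, hue, sub_self])
  have h1 : (S.m (n+2)).mulVec z j ≠ 0 := by
    rw [hze]; simp [e, huj]
  obtain ⟨k, hk, hzk⟩ := S.exists_of_mulVec_ne h1
  have := hz k hzk
  have h2 := S.mle _ _ _ hk
  have h3 := S.mne _ _ _ hk
  rw [hj] at h2 h3
  exact h3 (le_antisymm h2 this)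

end Str
namespace Crown

variable {s : ℕ}

/-- edge in a vertex set -/
def dep (S : Finset (Fin s ⊕ Fin s)) : Prop :=
  ∃ i j : Fin s, i ≠ j ∧ Sum.inl i ∈ S ∧ Sum.inr j ∈ S

/-- monomials in the ideal -/
def PP (w : Fin s → ℕ) (b : (Fin s ⊕ Fin s) →₀ ℕ) : Prop :=
  ∃ i j : Fin s, i ≠ j ∧ 1 ≤ b (Sum.inl i) ∧ w j ≤ b (Sum.inr j)

/-- top degree -/
def th (w : Fin s → ℕ) (v : Fin s ⊕ Fin s) : ℕ := Sum.elim (fun _ => 1) w v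

/-- `S` is the set where `b` is full -/
def Full (w : Fin s → ℕ) (b : (Fin s ⊕ Fin s) →₀ ℕ) (S : Finset (Fin s ⊕ Fin s)) : Prop :=
  ∀ v, (v ∈ S → b v = th w v) ∧ (v ∉ S → b v < th w v)

lemma PP_mono (w : Fin s → ℕ) (a b : (Fin s ⊕ Fin s) →₀ ℕ) (h : a ≤ b) (ha : PP w a) :
    PP w b := by
  obtain ⟨i, j, hij, h1, h2⟩ := ha
  exact ⟨i, j, hij, h1.trans (h _), h2.trans (h _)⟩

lemma PP_iff (w : Fin s → ℕ) {b : (Fin s ⊕ Fin s) →₀ ℕ} {S : Finset (Fin s ⊕ Fin s)}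
    (h : Full w b S) : PP w b ↔ dep S := by
  constructor
  · rintro ⟨i, j, hij, h1, h2⟩
    refine ⟨i, j, hij, ?_, ?_⟩
    · by_contra hn
      have := (h _).2 hn
      simp [th] at this
      omega
    · by_contra hn
      have := (h _).2 hn
      simp [th] at this
      omega
  · rintro ⟨i, j, hij, h1, h2⟩
    refine ⟨i, j, hij, ?_, ?_⟩
    · rw [(h _).1 h1]; simp [th]
    · rw [(h _).1 h2]; simp [th]

lemma dep_mono {S T : Finset (Fin s ⊕ Fin s)} (h : S ⊆ T) (hS : dep S) : dep T := by
  obtain ⟨i, j, hij, h1, h2⟩ := hS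
  exact ⟨i, j, hij, h h1, h h2⟩

variable {K : Type} [Field K] {w : Fin s → ℕ}
  (S : Str K (Fin s ⊕ Fin s) (PP w))

/-- uniform exactness -/
def ExN (n : ℕ) (U N : Finset (Fin s ⊕ Fin s)) : Prop :=
  ∀ b, Full w b (U ∪ N) → S.Ex n U b

lemma ExN_indep (n : ℕ) (U N : Finset (Fin s ⊕ Fin s)) (h : ¬ dep (U ∪ N)) : ExN S n U N := by
  intro b hb
  apply S.Ex_of_not
  rwa [PP_iff w hb]


lemma th_pos (hw : ∀ j, 1 ≤ w j) (v : Fin s ⊕ Fin s) : 1 ≤ th w v := by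
  rcases v with i | j
  · simp [th]
  · simpa [th] using hw j


lemma step (hw : ∀ j, 1 ≤ w j) (hd1 : ∀ j, S.deg 1 j = 0)
    (n : ℕ) (U N : Finset (Fin s ⊕ Fin s)) (v : Fin s ⊕ Fin s) (hv : v ∉ U) (hvN : v ∉ N)
    (h1 : ExN S n U (insert v N)) (h2 : ∀ m, n = m + 1 → ExN S m U N) :
    ExN S n (insert v U) N := by
  intro b hb
  apply S.MV (PP_mono w) hd1 _ _ _ _ hv
  · apply h1
    rwa [Finset.union_insert, ← Finset.insert_union]
  · intro m hm
    apply h2 m hm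
    intro t
    have := hb t
    have hp := th_pos hw t
    by_cases htv : v = t
    · subst htv
      have h3 := this.1 (by simp)
      simp [hv, hvN]
      omega
    · simpa [Finsupp.single_apply, htv, Ne.symm htv] using this

lemma coneN (hw : ∀ j, 1 ≤ w j) (hd1 : ∀ j, S.deg 1 j = 0)
    (n : ℕ) (U N : Finset (Fin s ⊕ Fin s)) (hU : U.Nonempty) (hd : Disjoint U N)
    (hN : dep N) : ExN S n U N := by
  intro b hb
  obtain ⟨v, hv⟩ := hU
  rw [← Finset.insert_erase hv]
  apply S.cone (PP_mono w) hd1 _ _ (by simp)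
  intro c hc hcu _
  obtain ⟨i, j, hij, h1, h2⟩ := hN
  have key : ∀ t ∈ N, (c - Finsupp.single v 1 : (Fin s ⊕ Fin s) →₀ ℕ) t = th w t := by
    intro t ht
    have htU : t ∉ U := fun h => (Finset.disjoint_left.1 hd h ht)
    have htv : v ≠ t := fun h => htU (h ▸ hv)
    have := hcu t (by simp [htU])
    simp [Finsupp.single_apply, Ne.symm htv, this, (hb t).1 (by simp [ht])]
  refine ⟨i, j, hij, ?_, ?_⟩
  · rw [key _ h1]; simp [th]
  · rw [key _ h2]; simp [th]

lemma L0 (hw : ∀ j, 1 ≤ w j) (hd1 : ∀ j, S.deg 1 j = 0)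
    (U : Finset (Fin s ⊕ Fin s)) : ∀ N, Disjoint U N → ∀ n, U.card + 1 ≤ n → ExN S n U N := by
  induction U using Finset.induction_on with
  | empty =>
    intro N _ n hn b _
    obtain ⟨n, rfl⟩ : ∃ m, n = m + 1 := ⟨n - 1, by simp at hn; omega⟩
    exact S.Ex_empty _ _
  | insert v U hv ih =>
    intro N hd n hn
    rw [Finset.card_insert_of_notMem hv] at hn
    rw [Finset.disjoint_insert_left] at hd
    apply step S hw hd1 _ _ _ _ hv hd.1
    · exact ih _ (by simp [hv, hd.2]) _ (by omega)
    · intro m hm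
      exact ih _ hd.2 _ (by omega)

lemma L1 (hw : ∀ j, 1 ≤ w j) (hd1 : ∀ j, S.deg 1 j = 0)
    (U N : Finset (Fin s ⊕ Fin s)) (hN : ¬ dep N) :
    Disjoint U N → ∀ n, U.card ≤ n → ExN S n U N := by
  induction U using Finset.induction_on with
  | empty =>
    intro _ n hn
    exact ExN_indep S _ _ _ (by simpa using hN)
  | insert v U hv ih =>
    intro hd n hn
    rw [Finset.card_insert_of_notMem hv] at hn
    rw [Finset.disjoint_insert_left] at hd
    apply step S hw hd1 _ _ _ _ hv hd.1
    · exact L0 S hw hd1 _ _ (by simp [hv, hd.2]) _ (by omega)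
    · intro m hm
      exact ih hd.2 _ (by omega)

lemma L2 (hw : ∀ j, 1 ≤ w j) (hd1 : ∀ j, S.deg 1 j = 0)
    (v : Fin s ⊕ Fin s) (U N : Finset (Fin s ⊕ Fin s)) (hN : ¬ dep (insert v N)) :
    v ∉ U → Disjoint (insert v U) N → ∀ n, (insert v U).card ≤ n + 1 → ExN S n (insert v U) N := by
  induction U using Finset.induction_on with
  | empty =>
    intro _ _ n hn
    exact ExN_indep S _ _ _ (by simpa using hN)
  | insert u U hu ih =>
    intro hvU hd n hn
    simp only [Finset.mem_insert, not_or] at hvU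
    rw [Finset.insert_comm] at hd hn ⊢
    have huvU : u ∉ insert v U := by simp [hu, Ne.symm hvU.1]
    rw [Finset.card_insert_of_notMem huvU] at hn
    rw [Finset.disjoint_insert_left] at hd
    have hd' : Disjoint (insert v U) (insert u N) := by
      rw [Finset.disjoint_insert_right]; exact ⟨huvU, hd.2⟩
    apply step S hw hd1 _ _ _ _ huvU hd.1
    · by_cases h : dep (insert u N)
      · exact coneN S hw hd1 _ _ _ (by simp) hd' h
      · exact L1 S hw hd1 _ _ h hd' _ (by omega)
    · intro m hm
      exact ih hvU.2 hd.2 _ (by omega)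

lemma L2' (hw : ∀ j, 1 ≤ w j) (hd1 : ∀ j, S.deg 1 j = 0)
    (v : Fin s ⊕ Fin s) (U N : Finset (Fin s ⊕ Fin s)) (hN : ¬ dep (insert v N))
    (hv : v ∈ U) (hd : Disjoint U N) (n : ℕ) (hn : U.card ≤ n + 1) : ExN S n U N := by
  have := L2 S hw hd1 v (U.erase v) N hN (by simp)
  rw [Finset.insert_erase hv] at this
  exact this hd n hn

lemma L3 (hw : ∀ j, 1 ≤ w j) (hd1 : ∀ j, S.deg 1 j = 0)
    (i : Fin s) (U : Finset (Fin s ⊕ Fin s)) :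
    (∀ v ∈ U, v ≠ Sum.inl i ∧ v ≠ Sum.inr i) → ∀ n, (U ∪ {Sum.inl i, Sum.inr i}).card ≤ n + 2 →
      ExN S n (U ∪ {Sum.inl i, Sum.inr i}) ∅ := by
  induction U using Finset.induction_on with
  | empty =>
    intro _ n _
    apply ExN_indep
    rintro ⟨a, b, hab, h1, h2⟩
    simp at h1 h2
    exact hab (h1.trans h2.symm)
  | insert u U hu ih =>
    intro hU n hn
    have hu2 := hU u (by simp)
    rw [Finset.insert_union] at hn ⊢
    have hnot : u ∉ U ∪ {Sum.inl i, Sum.inr i} := by simp [hu, hu2]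
    rw [Finset.card_insert_of_notMem hnot] at hn
    have h2 : 2 ≤ (U ∪ {Sum.inl i, Sum.inr i}).card := by
      refine le_trans ?_ (Finset.card_le_card (Finset.subset_union_right (s₁ := U)))
      simp
    have hn1 : 1 ≤ n := by omega
    apply step S hw hd1 _ _ _ _ hnot (by simp)
    · rcases u with k | k
      · apply L2' S hw hd1 (Sum.inl i)
        · rintro ⟨a, b, hab, h1, h2⟩
          simp at h2
        · simp
        · simpa using hnot
        · omega
      · apply L2' S hw hd1 (Sum.inr i)
        · rintro ⟨a, b, hab, h1, h2⟩
          simp at h1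
        · simp
        · simpa using hnot
        · omega
    · intro m hm
      exact ih (fun v hv => hU v (by simp [hv])) _ (by omega)

lemma L3' (hw : ∀ j, 1 ≤ w j) (hd1 : ∀ j, S.deg 1 j = 0)
    (i : Fin s) (U : Finset (Fin s ⊕ Fin s)) (h1 : Sum.inl i ∈ U) (h2 : Sum.inr i ∈ U)
    (n : ℕ) (hn : U.card ≤ n + 2) : ExN S n U ∅ := by
  have h := L3 S hw hd1 i (U \ {Sum.inl i, Sum.inr i}) (by simp) n
  have e : U \ {Sum.inl i, Sum.inr i} ∪ {Sum.inl i, Sum.inr i} = U := by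
    apply Finset.sdiff_union_of_subset
    intro v hv
    simp at hv
    rcases hv with rfl | rfl <;> assumption
  rw [e] at h
  exact h hn

lemma exists_dep (U N : Finset (Fin s ⊕ Fin s)) (hN : 2 ≤ N.card) (h : dep (U ∪ N))
    (hn : ¬ dep N) : ∃ v ∈ U, dep (insert v N) := by
  by_contra hc
  push Not at hc
  obtain ⟨i, j, hij, h1, h2⟩ := h
  have hx : ∀ k, Sum.inl k ∈ N → k ≠ j → False := by
    intro k hk hkj
    rcases Finset.mem_union.1 h2 with h | h
    · exact hc _ h ⟨k, j, hkj, by simp [hk], by simp⟩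
    · exact hn ⟨k, j, hkj, hk, h⟩
  have hy : ∀ k, Sum.inr k ∈ N → k ≠ i → False := by
    intro k hk hkj
    rcases Finset.mem_union.1 h1 with h | h
    · exact hc _ h ⟨i, k, hkj.symm, by simp, by simp [hk]⟩
    · exact hn ⟨i, k, hkj.symm, h, hk⟩
  have hsub : N ⊆ {Sum.inl j, Sum.inr i} := by
    rintro (k | k) hk
    · have : k = j := by_contra fun h => hx k hk h
      simp [this]
    · have : k = i := by_contra fun h => hy k hk h
      simp [this]
  have heq : N = {Sum.inl j, Sum.inr i} := by
    apply Finset.eq_of_subset_of_card_le hsub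
    simpa using hN
  exact hn ⟨j, i, hij.symm, by simp [heq], by simp [heq]⟩

lemma M2 (hw : ∀ j, 1 ≤ w j) (hd1 : ∀ j, S.deg 1 j = 0)
    (k : ℕ) : ∀ (U N : Finset (Fin s ⊕ Fin s)), U.card = k → 2 ≤ N.card → Disjoint U N →
    ∀ n, n + 2 ≤ U.card → ExN S n U N := by
  induction k with
  | zero => intro U N hk hN hd n hn; omega
  | succ k ih =>
    intro U N hk hN hd n hn
    by_cases hdN : dep N
    · exact coneN S hw hd1 _ _ _ (Finset.card_pos.1 (by omega)) hd hdN
    by_cases hUN : dep (U ∪ N)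
    swap
    · exact ExN_indep S _ _ _ hUN
    obtain ⟨v, hv, hvN⟩ := exists_dep U N hN hUN hdN
    have hcard := Finset.card_erase_add_one hv
    have hvN' : v ∉ N := Finset.disjoint_left.1 hd hv
    have hd' : Disjoint (U.erase v) N := hd.mono_left (Finset.erase_subset _ _)
    rw [← Finset.insert_erase hv]
    apply step S hw hd1 _ _ _ _ (by simp) hvN'
    · apply coneN S hw hd1 _ _ _ (Finset.card_pos.1 (by omega)) _ hvN
      rw [Finset.disjoint_insert_right]
      exact ⟨by simp, hd'⟩
    · intro m hm
      exact ih _ _ (by omega) hN hd' _ (by omega)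

lemma M1 (hw : ∀ j, 1 ≤ w j) (hd1 : ∀ j, S.deg 1 j = 0)
    (U : Finset (Fin s ⊕ Fin s)) : ∀ N, N.card = 1 → Disjoint U N → ∀ n, n + 3 ≤ U.card →
    ExN S n U N := by
  induction U using Finset.induction_on with
  | empty => intro N _ _ n hn; simp at hn
  | insert v U hv ih =>
    intro N hN hd n hn
    rw [Finset.card_insert_of_notMem hv] at hn
    rw [Finset.disjoint_insert_left] at hd
    apply step S hw hd1 _ _ _ _ hv hd.1
    · exact M2 S hw hd1 _ _ _ rfl (by rw [Finset.card_insert_of_notMem hd.1]; omega)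
        (by simp [hv, hd.2]) _ (by omega)
    · intro m hm
      exact ih _ hN hd.2 _ (by omega)

lemma M0 (hw : ∀ j, 1 ≤ w j) (hd1 : ∀ j, S.deg 1 j = 0)
    (U : Finset (Fin s ⊕ Fin s)) : ∀ n, n + 4 ≤ U.card →
    ExN S n U ∅ := by
  induction U using Finset.induction_on with
  | empty => intro n hn; simp at hn
  | insert v U hv ih =>
    intro n hn
    rw [Finset.card_insert_of_notMem hv] at hn
    apply step S hw hd1 _ _ _ _ hv (by simp)
    · exact M1 S hw hd1 _ _ (by simp) (by simp [hv]) _ (by omega)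
    · intro m hm
      exact ih _ (by omega)

/-- vanishing in degrees that are not restrictions of the top degree -/
lemma cone_bad (hw : ∀ j, 1 ≤ w j) (hd1 : ∀ j, S.deg 1 j = 0)
    (a : (Fin s ⊕ Fin s) →₀ ℕ) (v : Fin s ⊕ Fin s) (h0 : a v ≠ 0)
    (h1 : a v ≠ th w v) (n : ℕ) : S.Ex n a.support a := by
  have hv : v ∈ a.support := by simpa using h0
  rw [← Finset.insert_erase hv]
  apply S.cone (PP_mono w) hd1 _ _ (by simp)
  rintro c hc hcu ⟨i, j, hij, h2, h3⟩
  have hcv : c v = a v := hcu v (by simp)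
  refine ⟨i, j, hij, ?_, ?_⟩
  · by_cases e : v = Sum.inl i
    · subst e
      simp [th] at h1 ⊢
      omega
    · simpa [Finsupp.single_apply, e, Ne.symm e] using h2
  · by_cases e : v = Sum.inr j
    · subst e
      simp [th] at h1 ⊢
      omega
    · simpa [Finsupp.single_apply, e, Ne.symm e] using h3

lemma full_supp (hw : ∀ j, 1 ≤ w j) (a : (Fin s ⊕ Fin s) →₀ ℕ) (h : ∀ v, a v ≠ 0 → a v = th w v) :
    Full w a (a.support ∪ ∅) := by
  intro v
  have := th_pos hw v
  constructor
  · intro hv; exact h v (by simpa using hv)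
  · intro hv; simp at hv; omega

lemma top_vanish (hw : ∀ j, 1 ≤ w j) (hd1 : ∀ j, S.deg 1 j = 0)
    (hs : 2 ≤ s) (n : ℕ) (hn : 2 * s - 3 ≤ n) (a : (Fin s ⊕ Fin s) →₀ ℕ)
    (ha : 2 * s - 3 < n ∨ ∃ v, a v ≠ th w v) : S.Ex n a.support a := by
  by_cases hbad : ∃ v, a v ≠ 0 ∧ a v ≠ th w v
  · obtain ⟨v, h0, h1⟩ := hbad
    exact cone_bad S hw hd1 a v h0 h1 n
  push Not at hbad
  have hF := full_supp hw a hbad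
  by_cases hpair : ∃ i, Sum.inl i ∈ a.support ∧ Sum.inr i ∈ a.support
  · obtain ⟨i, h1, h2⟩ := hpair
    apply L3' S hw hd1 i _ h1 h2 _ _ a hF
    have hle : a.support.card ≤ 2 * s := by
      refine (Finset.card_le_univ _).trans ?_
      simp; omega
    rcases ha with ha | ⟨v, hv⟩
    · omega
    · have hvs : v ∉ a.support := by
        intro h
        exact hv (hbad v (by simpa using h))
      have := Finset.card_lt_univ_of_notMem hvs
      simp at this
      omega
  · push Not at hpair
    have hle : a.support.card ≤ s := by
      have : (a.support.image (Sum.elim id id : Fin s ⊕ Fin s → Fin s)).card = a.support.card := by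
        apply Finset.card_image_of_injOn
        rintro (i | i) hi (j | j) hj h <;> simp only [Sum.elim_inl, Sum.elim_inr, id] at h <;>
          subst h
        · rfl
        · exact absurd hj (hpair _ hi)
        · exact absurd hi (hpair _ hj)
        · rfl
      rw [← this]
      simpa using Finset.card_le_univ (a.support.image (Sum.elim id id : Fin s ⊕ Fin s → Fin s))
    rcases a.support.eq_empty_or_nonempty with he | ⟨v, hv⟩
    · apply S.Ex_of_not
      rintro ⟨i, j, _, h, _⟩
      have : a = 0 := by simpa using he
      simp [this] at h
    · apply L2' S hw hd1 v _ _ _ hv (by simp) _ (by omega) a hF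
      rintro ⟨i, j, hij, h1, h2⟩
      simp at h1 h2
      rw [← h2] at h1
      simp at h1

lemma low_vanish (hw : ∀ j, 1 ≤ w j) (hd1 : ∀ j, S.deg 1 j = 0)
    (n : ℕ) (hn : n + 4 ≤ 2 * s) (a : (Fin s ⊕ Fin s) →₀ ℕ)
    (ha : ∀ v, a v = th w v) : S.Ex n a.support a := by
  apply M0 S hw hd1 _ _ _ a (full_supp hw a fun v _ => ha v)
  have : a.support = Finset.univ := by
    ext v
    have := th_pos hw v
    have := ha v
    simp; omega
  rw [this]
  simp; omega

end Crown
namespace Str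

variable {K : Type} [Field K] {σ : Type} {P : (σ →₀ ℕ) → Prop}

open Classical in
lemma euler (S : Str K σ P) [IsEmpty (S.ι 0)] [Unique (S.ι 1)] (hd1 : ∀ j, S.deg 1 j = 0)
    (M : ℕ) (hM : IsEmpty (S.ι (M+2))) (b : σ →₀ ℕ) (hb : P b) :
    ∑ i ∈ Finset.range M, (-1 : ℤ)^i * (Fintype.card {j : S.ι (i+2) // S.deg _ j ≤ b} : ℤ) = 1 := by
  let A : ∀ n, Matrix {j : S.ι n // S.deg _ j ≤ b} {j : S.ι (n+1) // S.deg _ j ≤ b} K :=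
    fun n => (S.m n).submatrix Subtype.val Subtype.val
  -- extension by zero
  let ext : ∀ n, ({j : S.ι n // S.deg _ j ≤ b} → K) → (S.ι n → K) :=
    fun n z j => if h : S.deg n j ≤ b then z ⟨j, h⟩ else 0
  have hext : ∀ n z j, ext n z j ≠ 0 → S.deg n j ≤ b := by
    intro n z j h
    by_contra hc
    simp [ext, hc] at h
  have hextv : ∀ n z (j : {j : S.ι n // S.deg _ j ≤ b}), ext n z j = z j := by
    intro n z j
    simp [ext, j.2]
  have hA : ∀ n z j, (A n).mulVec z j = (S.m n).mulVec (ext (n+1) z) j.1 := by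
    intro n z j
    simp only [A, Matrix.mulVec, dotProduct, Matrix.submatrix_apply]
    rw [← Finset.sum_subset (Finset.subset_univ (Finset.univ.filter fun k => S.deg (n+1) k ≤ b))]
    · letI : Fintype {k // S.deg (n+1) k ≤ b} := inferInstance
      rw [Finset.sum_subtype (F := this) (p := fun k => S.deg (n+1) k ≤ b)
        (Finset.univ.filter fun k => S.deg (n+1) k ≤ b) (by simp)
        (fun k => S.m n j k * ext (n+1) z k)]
      simp only [hextv]
    · intro k _ hk
      simp at hk
      simp [ext, hk]
  have hA' : ∀ n z, ext n ((A n).mulVec z) = (S.m n).mulVec (ext (n+1) z) := by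
    intro n z
    funext j
    by_cases h : S.deg n j ≤ b
    · have := hA n z ⟨j, h⟩
      simp only [ext, h, dif_pos]
      exact this
    · by_contra hne
      have h0 : (S.m n).mulVec (ext (n+1) z) j ≠ 0 := by
        intro h0; apply hne; simp [ext, h]; simpa [ext] using h0.symm
      exact h (S.deg_bdry (hext _ _) j h0)
  have hinj : ∀ n z z', ext n z = ext n z' → z = z' := by
    intro n z z' h
    funext j
    rw [← hextv n z j, h, hextv]
  have hext0 : ∀ n, ext n 0 = 0 := by
    intro n; funext j; simp [ext]
  have hexact : ∀ n, LinearMap.range (Matrix.mulVecLin (A (n+1))) =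
      LinearMap.ker (Matrix.mulVecLin (A n)) := by
    intro n
    ext z
    simp only [LinearMap.mem_range, LinearMap.mem_ker, Matrix.mulVecLin_apply]
    constructor
    · rintro ⟨y, rfl⟩
      apply hinj
      rw [hA', hA', S.comp, hext0]
    · intro h
      obtain ⟨y, hy, e⟩ := S.ex b hb n (ext _ z) (hext _ _) (by rw [← hA', h, hext0])
      refine ⟨fun j => y j.1, ?_⟩
      apply hinj
      rw [hA', ← e]
      congr 1
      funext j
      by_cases hj : S.deg _ j ≤ b
      · simp [ext, hj]
      · simp only [ext, hj, dif_neg, not_false_iff]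
        by_contra hne
        exact hj (hy j (Ne.symm hne))
  let r : ℕ → ℕ := fun n => Module.finrank K (LinearMap.range (Matrix.mulVecLin (A n)))
  have hr : ∀ n, r n + r (n+1) = Fintype.card {j : S.ι (n+1) // S.deg _ j ≤ b} := by
    intro n
    have := LinearMap.finrank_range_add_finrank_ker (Matrix.mulVecLin (A n))
    rw [← hexact, Module.finrank_fintype_fun_eq_card] at this
    exact this
  have hr0 : r 0 = 0 := by
    have : Subsingleton ({j : S.ι 0 // S.deg _ j ≤ b} → K) := inferInstance
    exact Module.finrank_zero_of_subsingleton
  have hc1 : Fintype.card {j : S.ι 1 // S.deg _ j ≤ b} = 1 := by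
    rw [Fintype.card_eq_one_iff]
    refine ⟨⟨default, by rw [hd1]; exact zero_le⟩, ?_⟩
    rintro ⟨j, hj⟩
    exact Subtype.ext (Subsingleton.elim _ _)
  have hr1 : r 1 = 1 := by have := hr 0; rw [hr0, zero_add, hc1] at this; exact this
  have key : ∀ N, ∑ i ∈ Finset.range N, (-1 : ℤ)^i *
      (Fintype.card {j : S.ι (i+2) // S.deg _ j ≤ b} : ℤ) = 1 - (-1)^N * r (N+1) := by
    intro N
    induction N with
    | zero => simp [hr1]
    | succ N ih =>
      rw [Finset.sum_range_succ, ih, ← hr (N+1)]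
      push_cast
      ring
  rw [key]
  have : r (M+1) = 0 := by
    have h1 := hr (M+1)
    change _ = Fintype.card {j : S.ι (M+2) // S.deg _ j ≤ b} at h1
    have : Fintype.card {j : S.ι (M+2) // S.deg _ j ≤ b} = 0 := by
      rw [Fintype.card_eq_zero_iff]
      exact ⟨fun j => hM.elim j.1⟩
    omega
  simp [this]

end Str

namespace Crown

variable {s : ℕ}

/-- top degree minus an indicator -/
noncomputable def thm (w : Fin s → ℕ) (τ : Finset (Fin s ⊕ Fin s)) : (Fin s ⊕ Fin s) →₀ ℕ :=
  Finsupp.equivFunOnFinite.symm (fun v => th w v - if v ∈ τ then 1 else 0)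

open Classical in
lemma incl_excl (w : Fin s → ℕ) (hw : ∀ j, 1 ≤ w j) (d Θ : (Fin s ⊕ Fin s) →₀ ℕ)
    (hΘ : ∀ v, Θ v = th w v) :
    ∑ τ : Finset (Fin s ⊕ Fin s), (-1 : ℤ)^τ.card * (if d ≤ thm w τ then 1 else 0) =
      if d = Θ then 1 else 0 := by
  by_cases hd : d ≤ Θ
  · let T := Finset.univ.filter fun v => d v < th w v
    have h1 : ∀ τ : Finset (Fin s ⊕ Fin s), d ≤ thm w τ ↔ τ ⊆ T := by
      intro τ
      constructor
      · intro h v hv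
        have h2 := h v
        have := th_pos hw v
        simp [thm, hv] at h2
        simp [T]; omega
      · intro h v
        have h3 := hd v
        rw [hΘ] at h3
        by_cases hv : v ∈ τ
        · have := h hv
          simp [T] at this
          simp [thm, hv]; omega
        · simpa [thm, hv] using h3
    simp only [h1, mul_ite, mul_one, mul_zero]
    rw [← Finset.sum_filter]
    have : (Finset.univ.filter fun τ => τ ⊆ T) = T.powerset := by ext; simp
    rw [this, Finset.sum_powerset_neg_one_pow_card]
    congr 1
    apply propext
    constructor
    · intro h
      apply le_antisymm hd
      intro v
      by_contra hv
      have : v ∈ T := by simp [T, ← hΘ]; omega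
      simp [h] at this
    · rintro rfl
      ext v; simp [T, hΘ]
  · have h2 : d ≠ Θ := by rintro rfl; exact hd le_rfl
    rw [if_neg h2]
    apply Finset.sum_eq_zero
    intro τ _
    rw [if_neg, mul_zero]
    intro h
    apply hd
    intro v
    refine (h v).trans ?_
    rw [hΘ]
    simp [thm]

lemma PP_thm (w : Fin s → ℕ) (hw : ∀ j, 1 ≤ w j) (τ : Finset (Fin s ⊕ Fin s)) :
    PP w (thm w τ) ↔ dep τᶜ := by
  apply PP_iff
  intro v
  have := th_pos hw v
  constructor
  · intro h; simp at h; simp [thm, h]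
  · intro h; simp at h; simp [thm, h]; omega

open Classical in
lemma dep_sum (hs : 1 ≤ s) :
    ∑ τ : Finset (Fin s ⊕ Fin s), (-1 : ℤ)^τ.card * (if dep τᶜ then 1 else 0) = 1 - s := by
  have e1 : ∑ τ : Finset (Fin s ⊕ Fin s), (-1 : ℤ)^τ.card * (if dep τᶜ then 1 else 0) =
      ∑ τ : Finset (Fin s ⊕ Fin s), (-1 : ℤ)^τ.card * (if dep τ then 1 else 0) := by
    refine Fintype.sum_equiv (Equiv.ofBijective compl compl_bijective) _ _ ?_
    intro τ
    simp only [Equiv.ofBijective_apply]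
    congr 1
    have : τ.card + τᶜ.card = 2 * s := by
      rw [Finset.card_add_card_compl]; simp; omega
    have h2 : (-1 : ℤ)^τ.card * (-1)^τᶜ.card = 1 := by
      rw [← pow_add, this, pow_mul]; simp
    rcases neg_one_pow_eq_or ℤ τ.card with h | h <;> rw [h] at h2 ⊢ <;> linarith
  have e2 : ∑ τ : Finset (Fin s ⊕ Fin s), (-1 : ℤ)^τ.card * (if dep τ then 1 else 0) =
      ∑ p : Finset (Fin s) × Finset (Fin s), (-1 : ℤ)^(p.1.card + p.2.card) *
        (if dep (p.1.disjSum p.2) then 1 else 0) := by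
    refine (Fintype.sum_equiv (Finset.sumEquiv (α := Fin s) (β := Fin s)).toEquiv.symm _ _ ?_).symm
    intro p
    change _ = (-1 : ℤ)^(p.1.disjSum p.2).card * (if dep (p.1.disjSum p.2) then 1 else 0)
    rw [Finset.card_disjSum]
  have e3 : ∀ A B : Finset (Fin s), (if dep (A.disjSum B) then (1 : ℤ) else 0) =
      (1 - if A = ∅ then 1 else 0) * (1 - if B = ∅ then 1 else 0) -
        ∑ i : Fin s, if A = {i} ∧ B = {i} then 1 else 0 := by
    intro A B
    by_cases hA : A = ∅
    · subst hA
      have : ¬ dep ((∅ : Finset (Fin s)).disjSum B) := by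
        rintro ⟨i, j, _, h, _⟩; simp at h
      rw [if_neg this]
      simp [Ne.symm (Finset.singleton_ne_empty _)]
    by_cases hB : B = ∅
    · subst hB
      have : ¬ dep (A.disjSum (∅ : Finset (Fin s))) := by
        rintro ⟨i, j, _, _, h⟩; simp at h
      rw [if_neg this]
      simp [Ne.symm (Finset.singleton_ne_empty _)]
    by_cases hi : ∃ i, A = {i} ∧ B = {i}
    · obtain ⟨i, rfl, rfl⟩ := hi
      have : ¬ dep (({i} : Finset (Fin s)).disjSum {i}) := by
        rintro ⟨a, b, hab, h, h'⟩
        simp at h h'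
        exact hab (h.trans h'.symm)
      simp [this, Finset.singleton_inj]
    · have h0 : ∑ i : Fin s, (if A = {i} ∧ B = {i} then (1 : ℤ) else 0) = 0 := by
        apply Finset.sum_eq_zero
        intro i _
        rw [if_neg]
        exact fun h => hi ⟨i, h⟩
      have : dep (A.disjSum B) := by
        by_contra hnd
        have hall : ∀ a ∈ A, ∀ b ∈ B, a = b := by
          intro a ha b hb
          by_contra hab
          exact hnd ⟨a, b, hab, by simpa using ha, by simpa using hb⟩
        obtain ⟨a, ha⟩ := Finset.nonempty_iff_ne_empty.2 hA
        obtain ⟨b, hb⟩ := Finset.nonempty_iff_ne_empty.2 hB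
        apply hi
        refine ⟨a, ?_, ?_⟩
        · rw [Finset.eq_singleton_iff_unique_mem]
          exact ⟨ha, fun x hx => (hall x hx b hb).trans (hall a ha b hb).symm⟩
        · rw [Finset.eq_singleton_iff_unique_mem]
          exact ⟨(hall a ha b hb) ▸ hb, fun x hx => (hall a ha x hx).symm⟩
      simp [this, h0, hA, hB]
  have e4 : ∑ A : Finset (Fin s), (-1 : ℤ)^A.card * (1 - if A = ∅ then 1 else 0) = -1 := by
    simp only [mul_sub, mul_one, Finset.sum_sub_distrib]
    have : ∑ A : Finset (Fin s), (-1 : ℤ)^A.card = 0 := by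
      have h := Finset.sum_powerset_neg_one_pow_card (x := (Finset.univ : Finset (Fin s)))
      rw [Finset.powerset_univ] at h
      rw [h, if_neg]
      intro h0
      have := congrArg Finset.card h0
      simp at this; omega
    rw [this]
    simp
  rw [e1, e2]
  simp only [e3]
  rw [Finset.sum_congr rfl (fun p _ => mul_sub _ _ _), Finset.sum_sub_distrib]
  congr 1
  · rw [Fintype.sum_prod_type]
    have : ∀ A B : Finset (Fin s), (-1 : ℤ)^(A.card + B.card) *
        ((1 - if A = ∅ then 1 else 0) * (1 - if B = ∅ then 1 else 0)) =
        ((-1 : ℤ)^A.card * (1 - if A = ∅ then 1 else 0)) *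
        ((-1 : ℤ)^B.card * (1 - if B = ∅ then 1 else 0)) := by
      intro A B; rw [pow_add]; ring
    simp only [this]
    simp only [← Finset.mul_sum, ← Finset.sum_mul, e4]
    norm_num
  · simp only [Finset.mul_sum]
    rw [Finset.sum_comm]
    have : ∀ i : Fin s, ∑ p : Finset (Fin s) × Finset (Fin s), (-1 : ℤ)^(p.1.card + p.2.card) *
        (if p.1 = {i} ∧ p.2 = {i} then 1 else 0) = 1 := by
      intro i
      rw [Finset.sum_eq_single ({i}, {i})]
      · simp
      · rintro ⟨A, B⟩ _ h
        rw [if_neg, mul_zero]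
        rintro ⟨rfl, rfl⟩
        exact h rfl
      · simp
    simp only [this]
    simp

open Classical in
lemma euler_top {K : Type} [Field K] {w : Fin s → ℕ} (hw : ∀ j, 1 ≤ w j) (hs : 1 ≤ s)
    (S : Str K (Fin s ⊕ Fin s) (PP w)) [IsEmpty (S.ι 0)] [Unique (S.ι 1)]
    (hd1 : ∀ j, S.deg 1 j = 0) (M : ℕ) (hM : IsEmpty (S.ι (M+2)))
    (Θ : (Fin s ⊕ Fin s) →₀ ℕ) (hΘ : ∀ v, Θ v = th w v) :
    ∑ i ∈ Finset.range M, (-1 : ℤ)^i * (Fintype.card {j : S.ι (i+2) // S.deg _ j = Θ} : ℤ)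
      = 1 - s := by
  have h1 : ∀ τ : Finset (Fin s ⊕ Fin s),
      ∑ i ∈ Finset.range M, (-1 : ℤ)^i * (Fintype.card {j : S.ι (i+2) // S.deg _ j ≤ thm w τ} : ℤ)
      = if dep τᶜ then 1 else 0 := by
    intro τ
    by_cases h : PP w (thm w τ)
    · rw [S.euler hd1 M hM _ h, if_pos ((PP_thm w hw τ).1 h)]
    · rw [if_neg (fun h' => h ((PP_thm w hw τ).2 h'))]
      apply Finset.sum_eq_zero
      intro i _
      have : Fintype.card {j : S.ι (i+2) // S.deg _ j ≤ thm w τ} = 0 := by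
        rw [Fintype.card_eq_zero_iff]
        exact ⟨fun j => h (PP_mono w _ _ j.2 (S.Pdeg _ _))⟩
      simp [this]
  have hc : ∀ (i : ℕ) (Q : S.ι (i+2) → Prop) [Fintype {j // Q j}], (Fintype.card {j : S.ι (i+2) // Q j} : ℤ) =
      ∑ j : S.ι (i+2), if Q j then 1 else 0 := by
    intro i Q _
    rw [Fintype.card_subtype]
    simp
  rw [← dep_sum hs]
  simp only [← h1, hc]
  simp only [Finset.mul_sum]
  conv_rhs => rw [Finset.sum_comm]
  apply Finset.sum_congr rfl
  intro i _
  rw [Finset.sum_comm]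
  apply Finset.sum_congr rfl
  intro j _
  have h5 := incl_excl w hw (S.deg _ j) Θ hΘ
  simp only [mul_left_comm _ ((-1 : ℤ)^i), ← Finset.mul_sum]
  congr 1
  convert h5.symm

end Crown
namespace MinFreeRes

variable {K : Type} [Field K] {σ : Type} {I : Ideal (MvPolynomial σ K)} (F : MinFreeRes I)

/-- index types -/
def ix : ℕ → Type
  | 0 => Empty
  | 1 => Unit
  | n+2 => Fin (F.rk n)

instance ixF : ∀ n, Fintype (F.ix n)
  | 0 => inferInstanceAs (Fintype Empty)
  | 1 => inferInstanceAs (Fintype Unit)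
  | n+2 => inferInstanceAs (Fintype (Fin (F.rk n)))

/-- degrees -/
def dg : ∀ n, F.ix n → (σ →₀ ℕ)
  | 0 => fun _ => 0
  | 1 => fun _ => 0
  | n+2 => fun j => F.deg n j

/-- polynomial matrices of the augmented complex -/
noncomputable def pM : ∀ n, Matrix (F.ix n) (F.ix (n+1)) (MvPolynomial σ K)
  | 0 => fun _ _ => 0
  | 1 => fun _ k => F.aug (Pi.single (M := fun _ : Fin (F.rk 0) => MvPolynomial σ K) k 1)
  | n+2 => F.d n

lemma pM_homog (n : ℕ) (j : F.ix n) (k : F.ix (n+1)) (e : σ →₀ ℕ)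
    (he : e ∈ (F.pM n j k).support) : F.dg n j + e = F.dg (n+1) k := by
  rcases n with _ | _ | n
  · exact j.elim
  · have := F.aug_homog k he
    simp only [Finset.mem_singleton] at this
    subst this
    exact zero_add _
  · exact F.d_homog n j k e he

lemma aug_fin (Z : Fin (F.rk 0) → MvPolynomial σ K) :
    ∑ k, F.aug (Pi.single k 1) * Z k = F.aug Z := by
  have : Z = ∑ k, Z k • (Pi.single (M := fun _ : Fin (F.rk 0) => MvPolynomial σ K) k 1) := by
    funext l
    simp [Finset.sum_apply, Pi.single_apply]
  conv_rhs => rw [this, map_sum]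
  simp only [map_smul, smul_eq_mul]
  exact Finset.sum_congr rfl fun k _ => mul_comm _ _

lemma aug_eq_s15 (Z : F.ix 2 → MvPolynomial σ K) (u : F.ix 1) :
    (F.pM 1).mulVec Z u = F.aug Z := F.aug_fin Z

lemma exact_zero_fin (Z : Fin (F.rk 0) → MvPolynomial σ K) :
    F.aug Z = 0 ↔ ∃ Y, (F.d 0).mulVec Y = Z := by
  have h := SetLike.ext_iff.1 F.exact_zero Z
  simp only [LinearMap.mem_range, LinearMap.mem_ker, Matrix.mulVecLin_apply] at h
  exact h.symm

lemma exact_succ_fin (n : ℕ) (Z : Fin (F.rk (n+1)) → MvPolynomial σ K) :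
    (F.d n).mulVec Z = 0 ↔ ∃ Y, (F.d (n+1)).mulVec Y = Z := by
  have h := SetLike.ext_iff.1 (F.exact_succ n) Z
  simp only [LinearMap.mem_range, LinearMap.mem_ker, Matrix.mulVecLin_apply] at h
  exact h.symm

lemma pM_exact (n : ℕ) (Z : F.ix (n+2) → MvPolynomial σ K) :
    (F.pM (n+1)).mulVec Z = 0 ↔ ∃ Y, (F.pM (n+2)).mulVec Y = Z := by
  rcases n with _ | n
  · have h2 : (F.pM 1).mulVec Z = 0 ↔ F.aug Z = 0 := by
      constructor
      · intro h0
        rw [← F.aug_eq_s15 Z ()]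
        exact congrFun h0 ()
      · intro h0
        funext u
        exact (F.aug_eq_s15 Z u).trans h0
    exact h2.trans (F.exact_zero_fin Z)
  · exact F.exact_succ_fin n Z

/-- uniqueness of the index in the augmentation spot -/
instance ixU : Unique (F.ix 1) := inferInstanceAs (Unique Unit)

instance ixE : IsEmpty (F.ix 0) := inferInstanceAs (IsEmpty Empty)

/-- scalar matrices -/
noncomputable def sm (n : ℕ) : Matrix (F.ix n) (F.ix (n+1)) K :=
  fun j k => coeff (F.dg (n+1) k - F.dg n j) (F.pM n j k)

lemma sm_le (n : ℕ) (j : F.ix n) (k : F.ix (n+1)) (h : F.sm n j k ≠ 0) :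
    F.dg n j ≤ F.dg (n+1) k := by
  have := F.pM_homog n j k _ (mem_support_iff.2 h)
  rw [← this]
  exact le_self_add

lemma pM_eq (n : ℕ) (j : F.ix n) (k : F.ix (n+1)) :
    F.pM n j k = monomial (F.dg (n+1) k - F.dg n j) (F.sm n j k) := by
  classical
  ext e
  rw [coeff_monomial]
  split_ifs with h
  · rw [← h]; rfl
  · by_contra hc
    have := F.pM_homog n j k e (mem_support_iff.2 hc)
    apply h
    rw [← this, add_tsub_cancel_left]

lemma sm_exists {n : ℕ} {z : F.ix (n+1) → K} {j : F.ix n}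
    (h : (F.sm n).mulVec z j ≠ 0) : ∃ k, F.sm n j k ≠ 0 ∧ z k ≠ 0 := by
  by_contra hc
  push Not at hc
  apply h
  rw [Matrix.mulVec, dotProduct]
  apply Finset.sum_eq_zero
  intro k _
  by_cases hk : F.sm n j k = 0
  · simp [hk]
  · simp [hc k hk]

lemma lift (n : ℕ) (b : σ →₀ ℕ) (z : F.ix (n+1) → K) (hz : ∀ k, z k ≠ 0 → F.dg (n+1) k ≤ b) :
    (F.pM n).mulVec (fun k => monomial (b - F.dg (n+1) k) (z k)) =
      fun j => monomial (b - F.dg n j) ((F.sm n).mulVec z j) := by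
  funext j
  simp only [Matrix.mulVec, dotProduct, map_sum]
  apply Finset.sum_congr rfl
  intro k _
  rw [pM_eq, monomial_mul]
  by_cases h1 : F.sm n j k = 0
  · simp [h1]
  by_cases h2 : z k = 0
  · simp [h2]
  congr 2
  rw [add_comm]
  exact tsub_add_tsub_cancel (hz k h2) (F.sm_le n j k h1)

open Classical in
lemma descend (n : ℕ) (b : σ →₀ ℕ) (Y : F.ix (n+1) → MvPolynomial σ K) (j : F.ix n)
    (hj : F.dg n j ≤ b) :
    coeff (b - F.dg n j) ((F.pM n).mulVec Y j) =
      (F.sm n).mulVec (fun k => if F.dg (n+1) k ≤ b then coeff (b - F.dg (n+1) k) (Y k) else 0) j := by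
  simp only [Matrix.mulVec, dotProduct, coeff_sum]
  apply Finset.sum_congr rfl
  intro k _
  rw [pM_eq, coeff_monomial_mul']
  by_cases h1 : F.sm n j k = 0
  · simp [h1]
  have h2 := F.sm_le n j k h1
  have h3 : F.dg (n+1) k - F.dg n j ≤ b - F.dg n j ↔ F.dg (n+1) k ≤ b := by
    rw [tsub_le_iff_right, tsub_add_cancel_of_le hj]
  by_cases h4 : F.dg (n+1) k ≤ b
  · rw [if_pos (h3.2 h4), if_pos h4]
    congr 2
    rw [tsub_tsub_tsub_cancel_right h2]
  · rw [if_neg (fun h => h4 (h3.1 h)), if_neg h4, mul_zero]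

variable {P : (σ →₀ ℕ) → Prop}

lemma dg_P (hP : ∀ a b, a ≤ b → P a → P b)
    (hI2 : ∀ p ∈ I, ∀ e ∈ p.support, P e) (n : ℕ) : ∀ k, P (F.dg (n+2) k) := by
  classical
  have hcol : ∀ (n : ℕ) (k : F.ix (n+2)), ∃ j, F.pM (n+1) j k ≠ 0 := by
    intro n k
    by_contra hc
    push Not at hc
    have h0 : (F.pM (n+1)).mulVec (Pi.single k 1) = 0 := by
      funext j
      simp [hc]
    obtain ⟨Y, hY⟩ := (F.pM_exact n _).1 h0
    have h1 := congrArg (coeff 0) (congrFun hY k)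
    rw [Pi.single_eq_same, coeff_zero_one, Matrix.mulVec, dotProduct, coeff_sum] at h1
    rw [Finset.sum_eq_zero] at h1
    · exact zero_ne_one h1
    · intro l _
      have : coeff 0 (F.pM (n+2) k l) = 0 := F.minimal n k l
      rw [← constantCoeff_eq] at this ⊢
      rw [map_mul, this, zero_mul]
  induction n with
  | zero =>
    intro k
    obtain ⟨j, hj⟩ := hcol 0 k
    obtain ⟨e, he⟩ := support_nonempty.2 hj
    have h1 := F.pM_homog 1 j k e he
    have h2 : F.pM 1 j k ∈ I := (F.range_aug _).1 ⟨_, rfl⟩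
    have h3 := hI2 _ h2 e he
    rw [← h1]
    exact hP _ _ le_add_self h3
  | succ n ih =>
    intro k
    obtain ⟨j, hj⟩ := hcol (n+1) k
    obtain ⟨e, he⟩ := support_nonempty.2 hj
    rw [← F.pM_homog _ j k e he]
    exact hP _ _ le_self_add (ih j)

open Classical in
/-- the strand structure of a resolution -/
noncomputable def toStr (hP : ∀ a b, a ≤ b → P a → P b)
    (hI1 : ∀ b, P b → ∀ c : K, monomial b c ∈ I)
    (hI2 : ∀ p ∈ I, ∀ e ∈ p.support, P e) : Str K σ P where
  ι := F.ix
  ft := F.ixF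
  deg := F.dg
  m := F.sm
  Pdeg := F.dg_P hP hI2
  mle := F.sm_le
  mne := by
    intro n j k h he
    apply h
    rw [sm, he, tsub_self]
    exact F.minimal n j k
  comp := by
    intro n y
    rcases n with _ | n
    · funext j
      exact j.elim
    let b : σ →₀ ℕ := ∑ k : F.ix (n+1+2), F.dg (n+1+2) k
    have hb : ∀ k : F.ix (n+1+2), F.dg (n+1+2) k ≤ b := fun k =>
      Finset.single_le_sum (f := fun k : F.ix (n+1+2) => F.dg (n+1+2) k) (fun _ _ => zero_le) (Finset.mem_univ k)
    have h1 := F.lift (n+1+1) b y (fun k _ => hb k)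
    have h2 := F.lift (n+1) b ((F.sm (n+1+1)).mulVec y) (by
      intro j hj
      obtain ⟨k, hk, _⟩ := F.sm_exists hj
      exact (F.sm_le _ _ _ hk).trans (hb k))
    rw [(F.pM_exact n _).2 ⟨_, h1⟩] at h2
    funext j
    have h3 := congrFun h2 j
    simp only [Pi.zero_apply] at h3
    exact monomial_eq_zero.1 h3.symm
  ex := by
    intro b hb n z hz hc
    have hY : ∃ Y, (F.pM (n+1)).mulVec Y = fun k => monomial (b - F.dg (n+1) k) (z k) := by
      rcases n with _ | n
      · obtain ⟨Y, hY⟩ := (F.range_aug _).2 (hI1 b hb (z ()))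
        refine ⟨Y, ?_⟩
        funext u
        refine (F.aug_eq_s15 Y u).trans (hY.trans ?_)
        change _ = monomial (b - 0) _
        rw [tsub_zero]
        rfl
      · apply (F.pM_exact n _).1
        rw [F.lift _ b z hz, hc]
        funext j
        simp
    obtain ⟨Y, hY⟩ := hY
    refine ⟨fun k => if F.dg (n+2) k ≤ b then coeff (b - F.dg (n+2) k) (Y k) else 0, ?_, ?_⟩
    · intro k hk
      by_contra h
      simp [h] at hk
    · funext j
      by_cases hj : F.dg (n+1) j ≤ b
      · rw [← F.descend (n+1) b Y j hj, hY, coeff_monomial, if_pos rfl]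
      · have hzj : z j = 0 := by
          by_contra h; exact hj (hz j h)
        rw [hzj]
        by_contra h
        obtain ⟨k, hk, hk2⟩ := F.sm_exists h
        have : F.dg (n+2) k ≤ b := by
          by_contra h'; simp [h'] at hk2
        exact hj ((F.sm_le _ _ _ hk).trans this)

end MinFreeRes

lemma Crown.span_eq {K : Type} [Field K] {s : ℕ} (w : Fin s → ℕ) :
    Ideal.span {p : MvPolynomial (Fin s ⊕ Fin s) K | ∃ i j : Fin s, i ≠ j ∧
      p = X (Sum.inl i) * X (Sum.inr j) ^ w j} =
    Ideal.span ((fun a => monomial a (1 : K)) '' {a | ∃ i j : Fin s, i ≠ j ∧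
      a = Finsupp.single (Sum.inl i) 1 + Finsupp.single (Sum.inr j) (w j)}) := by
  have key : ∀ i j : Fin s, (X (Sum.inl i) * X (Sum.inr j) ^ w j : MvPolynomial (Fin s ⊕ Fin s) K) =
      monomial (Finsupp.single (Sum.inl i) 1 + Finsupp.single (Sum.inr j) (w j)) (1 : K) := by
    intro i j
    rw [X_pow_eq_monomial, X, monomial_mul, one_mul]
  congr 1
  ext p
  constructor
  · rintro ⟨i, j, hij, rfl⟩
    exact ⟨_, ⟨i, j, hij, rfl⟩, (key i j).symm⟩
  · rintro ⟨a, ⟨i, j, hij, rfl⟩, rfl⟩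
    exact ⟨i, j, hij, (key i j).symm⟩

lemma Crown.le_iff {s : ℕ} (w : Fin s → ℕ) (i j : Fin s) (b : (Fin s ⊕ Fin s) →₀ ℕ) :
    Finsupp.single (Sum.inl i) 1 + Finsupp.single (Sum.inr j) (w j) ≤ b ↔
      1 ≤ b (Sum.inl i) ∧ w j ≤ b (Sum.inr j) := by
  constructor
  · intro h
    have h1 := h (Sum.inl i)
    have h2 := h (Sum.inr j)
    simp at h1 h2
    exact ⟨h1, h2⟩
  · rintro ⟨h1, h2⟩ (k | k)
    · by_cases h : i = k
      · subst h; simpa using h1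
      · simp [Finsupp.single_apply, h]
    · by_cases h : j = k
      · subst h; simpa using h2
      · simp [Finsupp.single_apply, h]

/-- The edge ideal `I_s = (x_i y_j^{w_j} : i ≠ j)` of the weighted oriented crown
graph `G_s` (`s ≥ 2`) has `pdim = 2s - 3`, and its top multigraded Betti
number is `s - 1` at `α = x_1⋯x_s·y_1^{w_1}⋯y_s^{w_s}` and `0` otherwise. -/
theorem stmt15 {K : Type} [Field K] (s : ℕ) (hs : 2 ≤ s)
    (w : Fin s → ℕ) (hw : ∀ j, 1 ≤ w j)
    (I : Ideal (MvPolynomial (Fin s ⊕ Fin s) K))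
    (hI : I = Ideal.span {p | ∃ i j : Fin s, i ≠ j ∧
      p = X (Sum.inl i) * X (Sum.inr j) ^ w j})
    (Θ : (Fin s ⊕ Fin s) →₀ ℕ)
    (hΘ : Θ = Finsupp.equivFunOnFinite.symm (Sum.elim (fun _ => 1) w))
    (F : MinFreeRes I) :
    F.IsPdim (2 * s - 3) ∧ ∀ a, F.cnt (2 * s - 3) a = if a = Θ then s - 1 else 0 := by
  classical
  have hI2 : ∀ p ∈ I, ∀ e ∈ p.support, Crown.PP w e := by
    intro p hp e he
    rw [hI, Crown.span_eq, mem_ideal_span_monomial_image] at hp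
    obtain ⟨a, ⟨i, j, hij, rfl⟩, hle⟩ := hp e he
    exact ⟨i, j, hij, (Crown.le_iff w i j e).1 hle⟩
  have hI1 : ∀ b, Crown.PP w b → ∀ c : K, monomial b c ∈ I := by
    rintro b ⟨i, j, hij, h⟩ c
    rw [hI, Crown.span_eq, mem_ideal_span_monomial_image]
    intro e he
    have : e = b := by
      have := support_monomial_subset he
      simpa using this
    subst this
    exact ⟨_, ⟨i, j, hij, rfl⟩, (Crown.le_iff w i j e).2 h⟩
  let S := F.toStr (Crown.PP_mono w) hI1 hI2
  have hd1 : ∀ j, S.deg 1 j = 0 := fun _ => rfl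
  have hΘv : ∀ v, Θ v = Crown.th w v := by
    intro v; rw [hΘ]; rfl
  have hcnt0 : ∀ i a, S.Ex i a.support a → F.cnt i a = 0 := by
    intro i a h
    have h2 := S.no_gen i a h
    have : IsEmpty {j : Fin (F.rk i) // F.deg i j = a} := ⟨fun j => h2 j.1 j.2⟩
    exact Nat.card_of_isEmpty
  have hrk : ∀ i, 2 * s - 3 < i → F.rk i = 0 := by
    intro i hi
    by_contra h
    let j : Fin (F.rk i) := ⟨0, Nat.pos_of_ne_zero h⟩
    exact S.no_gen i (F.deg i j) (Crown.top_vanish S hw hd1 hs i hi.le _ (Or.inl hi)) j rfl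
  have hoff : ∀ a, a ≠ Θ → F.cnt (2 * s - 3) a = 0 := by
    intro a ha
    apply hcnt0
    apply Crown.top_vanish S hw hd1 hs _ le_rfl
    right
    by_contra hc
    push Not at hc
    exact ha (Finsupp.ext fun v => (hc v).trans (hΘv v).symm)
  have htop : F.cnt (2 * s - 3) Θ = s - 1 := by
    have : IsEmpty (S.ι 0) := F.ixE
    letI : Unique (S.ι 1) := F.ixU
    have hM : IsEmpty (S.ι ((2 * s - 2) + 2)) := by
      have h0 := hrk (2 * s - 2) (by omega)
      exact ⟨fun j => absurd (show Fin (F.rk (2 * s - 2)) from j).2 (by omega)⟩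
    have h := Crown.euler_top hw (by omega) S hd1 (2 * s - 2) hM Θ hΘv
    have hc : ∀ i, (Fintype.card {j : S.ι (i+2) // S.deg _ j = Θ}) = F.cnt i Θ := by
      intro i
      rw [MinFreeRes.cnt, ← Nat.card_eq_fintype_card]
      rfl
    have hsucc : 2 * s - 2 = (2 * s - 3) + 1 := by omega
    rw [hsucc, Finset.sum_range_succ, Finset.sum_eq_zero, hc, Odd.neg_one_pow] at h
    · omega
    · exact ⟨s - 2, by omega⟩
    · intro i hi
      rw [Finset.mem_range] at hi
      rw [hc, hcnt0 i Θ (Crown.low_vanish S hw hd1 i (by omega) Θ hΘv)]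
      simp
  refine ⟨⟨?_, hrk⟩, ?_⟩
  · intro h0
    have : IsEmpty {j : Fin (F.rk (2 * s - 3)) // F.deg (2 * s - 3) j = Θ} :=
      ⟨fun j => absurd j.1.2 (by omega)⟩
    have h1 : F.cnt (2 * s - 3) Θ = 0 := Nat.card_of_isEmpty
    omega
  · intro a
    split_ifs with h
    · rw [h]; exact htop
    · exact hoff a h
end
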